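/- arXiv:1112.3696 — 3 statements merged into one kernel-verified Lean document; each statement's English description precedes it below -/
import Mathlib

section
/- Let X be a bounded Borel subset of ℝ, T : X → X Borel measurable, and μ a T-invariant probability measure absolutely continuous with density h satisfying ∫ |h(s) − h(s − σ)| ds ≤ C' |σ|^β for some C', β > 0 and all σ ∈ ℝ. Suppose (X,T,μ) satisfies the exponential concentration inequality with constant C > 0. Let ψ : ℝ → ℝ be a bounded, non-negative Lipschitz kernel with bounded support and ∫ ψ(s) ds = 1, and let (α_n) be positive reals. Then there exists a constant C_ψ > 0 such that for every n ≥ 1 and every t > C_ψ (α_n^β + 1/(√n α_n²)), μ({x : ∫ |ĥ_n(x; s) − h(s)| ds > t}) ≤ exp(−n α_n⁴ t² / (4 C Lip(ψ)²)), where ĥ_n(x; s) = (1/(n α_n)) Σ_{j=0}^{n−1} ψ((s − T^j x)/α_n). -/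
open MeasureTheory Real

noncomputable section

/-- `K` is separately Lipschitz in each of its `n` variables, with
`L j` a Lipschitz constant for the `j`-th variable. -/
def SepLip {n : ℕ} (K : (Fin n → ℝ) → ℝ) (L : Fin n → ℝ) : Prop :=
  ∀ (x : Fin n → ℝ) (j : Fin n) (y : ℝ),
    |K x - K (Function.update x j y)| ≤ L j * dist (x j) y

/-- The kernel density estimator as a function of the sample points. -/
def hatE (ψ : ℝ → ℝ) (n : ℕ) (a : ℝ) (x : Fin n → ℝ) (s : ℝ) : ℝ :=
  (1 / ((n : ℝ) * a)) * ∑ j, ψ ((s - x j) / a)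

lemma hatE_update (ψ : ℝ → ℝ) (n : ℕ) (a : ℝ) (x : Fin n → ℝ) (j : Fin n) (y s : ℝ) :
    hatE ψ n a x s - hatE ψ n a (Function.update x j y) s
      = (1 / ((n : ℝ) * a)) * (ψ ((s - x j) / a) - ψ ((s - y) / a)) := by
  unfold hatE
  rw [← mul_sub, ← Finset.sum_sub_distrib, Finset.sum_eq_single j]
  · simp
  · intro b _ hb
    simp [Function.update_of_ne hb]
  · simp

lemma psi_comp_integrable (ψ : ℝ → ℝ) (hψi : Integrable ψ) (a : ℝ) (ha : 0 < a) (p : ℝ) :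
    Integrable (fun s => ψ ((s - p) / a)) :=
  (hψi.comp_div ha.ne').comp_sub_right p

lemma psi_comp_integral (ψ : ℝ → ℝ) (a : ℝ) (ha : 0 < a) (p : ℝ) :
    ∫ s, ψ ((s - p) / a) = a * ∫ s, ψ s := by
  rw [integral_sub_right_eq_self (fun s => ψ (s / a)) p, Measure.integral_comp_div]
  simp [abs_of_pos ha]

lemma psi_shift (ψ : ℝ → ℝ) (hψi : Integrable ψ) (R : ℝ) (hR : 0 < R)
    (hsupp : ∀ u, R < |u| → ψ u = 0) (Lψ : ℝ) (hLψ : 0 ≤ Lψ)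
    (hlip : ∀ a b : ℝ, |ψ a - ψ b| ≤ Lψ * |a - b|) (a : ℝ) (ha : 0 < a) (p q : ℝ) :
    ∫ s, |ψ ((s - p) / a) - ψ ((s - q) / a)| ≤ 4 * R * Lψ * |p - q| := by
  set c : ℝ := Lψ * |p - q| / a with hc
  have hc0 : 0 ≤ c := by positivity
  have hI : ∀ r : ℝ, Integrable ((Set.Icc (r - a * R) (r + a * R)).indicator (fun _ : ℝ => c)) := by
    intro r
    rw [integrable_indicator_iff measurableSet_Icc]
    exact integrableOn_const (by simp)
  have hIv : ∀ r : ℝ, ∫ s, (Set.Icc (r - a * R) (r + a * R)).indicator (fun _ : ℝ => c) s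
      = 2 * a * R * c := by
    intro r
    rw [integral_indicator measurableSet_Icc, setIntegral_const]
    rw [Real.volume_real_Icc_of_le (by nlinarith [mul_pos ha hR])]
    simp only [smul_eq_mul]
    ring
  have hout : ∀ r s : ℝ, s ∉ Set.Icc (r - a * R) (r + a * R) → ψ ((s - r) / a) = 0 := by
    intro r s hs
    apply hsupp
    rw [abs_div, abs_of_pos ha, lt_div_iff₀ ha]
    by_contra hcon
    push Not at hcon
    have := abs_le.mp hcon
    exact hs ⟨by nlinarith, by nlinarith⟩
  calc ∫ s, |ψ ((s - p) / a) - ψ ((s - q) / a)|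
      ≤ ∫ s, ((Set.Icc (p - a * R) (p + a * R)).indicator (fun _ : ℝ => c) s
          + (Set.Icc (q - a * R) (q + a * R)).indicator (fun _ : ℝ => c) s) := by
        refine integral_mono ?_ ((hI p).add (hI q)) ?_
        · exact ((psi_comp_integrable ψ hψi a ha p).sub (psi_comp_integrable ψ hψi a ha q)).abs
        · intro s
          have hb : |ψ ((s - p) / a) - ψ ((s - q) / a)| ≤ c := by
            refine (hlip _ _).trans (le_of_eq ?_)
            rw [hc, ← sub_div, abs_div, abs_of_pos ha]
            rw [show s - p - (s - q) = -(p - q) by ring, abs_neg]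
            ring
          by_cases h1 : s ∈ Set.Icc (p - a * R) (p + a * R) <;>
          by_cases h2 : s ∈ Set.Icc (q - a * R) (q + a * R)
          · simp only [Set.indicator_of_mem h1, Set.indicator_of_mem h2]; linarith
          · simp only [Set.indicator_of_mem h1, Set.indicator_of_notMem h2]; linarith
          · simp only [Set.indicator_of_notMem h1, Set.indicator_of_mem h2]; linarith
          · simp only [Set.indicator_of_notMem h1, Set.indicator_of_notMem h2,
              hout p s h1, hout q s h2]; simp
    _ = 4 * R * Lψ * |p - q| := by
        rw [integral_add (hI p) (hI q), hIv, hIv, hc]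
        field_simp
        ring

lemma hatE_integrable (ψ : ℝ → ℝ) (hψi : Integrable ψ) (n : ℕ) (a : ℝ) (ha : 0 < a)
    (x : Fin n → ℝ) : Integrable (hatE ψ n a x) := by
  unfold hatE
  exact (integrable_finsetSum _ (fun j _ => psi_comp_integrable ψ hψi a ha (x j))).const_mul _

lemma hatE_integral (ψ : ℝ → ℝ) (hψi : Integrable ψ) (hψ1 : ∫ s, ψ s = 1) (n : ℕ) (hn : 1 ≤ n)
    (a : ℝ) (ha : 0 < a) (x : Fin n → ℝ) : ∫ s, hatE ψ n a x s = 1 := by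
  unfold hatE
  have hn' : (n : ℝ) ≠ 0 := by positivity
  rw [integral_const_mul, integral_finsetSum _ (fun j _ => psi_comp_integrable ψ hψi a ha (x j))]
  simp only [psi_comp_integral ψ a ha, hψ1]
  simp
  field_simp

/-- The functional to which concentration is applied. -/
def KE (ψ h : ℝ → ℝ) (n : ℕ) (a : ℝ) (x : Fin n → ℝ) : ℝ :=
  ∫ s, |hatE ψ n a x s - h s|

lemma KE_nonneg (ψ h : ℝ → ℝ) (n : ℕ) (a : ℝ) (x : Fin n → ℝ) : 0 ≤ KE ψ h n a x :=
  integral_nonneg (fun _ => abs_nonneg _)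

lemma KE_le_two (ψ h : ℝ → ℝ) (hψ0 : ∀ s, 0 ≤ ψ s) (hψi : Integrable ψ) (hψ1 : ∫ s, ψ s = 1)
    (hh0 : ∀ s, 0 ≤ h s) (hhi : Integrable h) (hh1 : ∫ s, h s = 1)
    (n : ℕ) (hn : 1 ≤ n) (a : ℝ) (ha : 0 < a) (x : Fin n → ℝ) : KE ψ h n a x ≤ 2 := by
  have hi := hatE_integrable ψ hψi n a ha x
  calc KE ψ h n a x ≤ ∫ s, (hatE ψ n a x s + h s) := by
        refine integral_mono (hi.sub hhi).abs (hi.add hhi) ?_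
        intro s
        have h1 : 0 ≤ hatE ψ n a x s := by
          unfold hatE
          exact mul_nonneg (by positivity) (Finset.sum_nonneg (fun j _ => hψ0 _))
        have h2 := hh0 s
        show |hatE ψ n a x s - h s| ≤ hatE ψ n a x s + h s
        rw [abs_le]
        constructor <;> linarith
    _ = 2 := by
        rw [integral_add hi hhi, hatE_integral ψ hψi hψ1 n hn a ha x, hh1]; norm_num

lemma KE_sepLip (ψ h : ℝ → ℝ) (hψi : Integrable ψ) (hhi : Integrable h) (R : ℝ) (hR : 0 < R)
    (hsupp : ∀ u, R < |u| → ψ u = 0) (Lψ : ℝ) (hLψ : 0 ≤ Lψ)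
    (hlip : ∀ a b : ℝ, |ψ a - ψ b| ≤ Lψ * |a - b|) (n : ℕ) (a : ℝ) (ha : 0 < a)
    (l : ℝ) (hl : 0 ≤ l) :
    SepLip (fun x : Fin n → ℝ => l * KE ψ h n a x) (fun _ => l * (4 * R * Lψ / (n * a))) := by
  intro x j y
  have hi := hatE_integrable ψ hψi n a ha
  have hd : |KE ψ h n a x - KE ψ h n a (Function.update x j y)|
      ≤ 4 * R * Lψ / (n * a) * |x j - y| := by
    unfold KE
    have j1 : ∀ z, Integrable (fun s => |hatE ψ n a z s - h s|) := fun z => ((hi z).sub hhi).abs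
    rw [← integral_sub (j1 x) (j1 _)]
    refine (abs_integral_le_integral_abs).trans ?_
    calc ∫ s, |(|hatE ψ n a x s - h s| - |hatE ψ n a (Function.update x j y) s - h s|)|
        ≤ ∫ s, (1 / ((n : ℝ) * a)) * |ψ ((s - x j) / a) - ψ ((s - y) / a)| := by
          refine integral_mono (((hi x).sub hhi).abs.sub ((hi _).sub hhi).abs).abs ?_ ?_
          · exact (((psi_comp_integrable ψ hψi a ha _).sub
              (psi_comp_integrable ψ hψi a ha _)).abs).const_mul _
          · intro s
            refine (abs_abs_sub_abs_le_abs_sub _ _).trans (le_of_eq ?_)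
            rw [sub_sub_sub_cancel_right, hatE_update, abs_mul, abs_of_nonneg (by positivity)]
      _ ≤ 4 * R * Lψ / (n * a) * |x j - y| := by
          rw [integral_const_mul]
          have := mul_le_mul_of_nonneg_left
            (psi_shift ψ hψi R hR hsupp Lψ hLψ hlip a ha (x j) y)
            (show (0 : ℝ) ≤ 1 / ((n : ℝ) * a) by positivity)
          refine this.trans (le_of_eq ?_)
          ring
  show |l * KE ψ h n a x - l * KE ψ h n a (Function.update x j y)| ≤ _
  rw [← mul_sub, abs_mul, abs_of_nonneg hl, Real.dist_eq, mul_assoc]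
  exact mul_le_mul_of_nonneg_left hd hl

lemma hatE_sepLip (ψ : ℝ → ℝ) (Lψ : ℝ)
    (hlip : ∀ a b : ℝ, |ψ a - ψ b| ≤ Lψ * |a - b|) (n : ℕ) (a : ℝ) (ha : 0 < a)
    (l : ℝ) (s : ℝ) :
    SepLip (fun x : Fin n → ℝ => l * hatE ψ n a x s) (fun _ => |l| * (Lψ / (n * a ^ 2))) := by
  intro x j y
  show |l * hatE ψ n a x s - l * hatE ψ n a (Function.update x j y) s| ≤ _
  rw [← mul_sub, abs_mul, hatE_update, abs_mul, mul_assoc, Real.dist_eq]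
  refine mul_le_mul_of_nonneg_left ?_ (abs_nonneg l)
  rw [abs_of_nonneg (by positivity)]
  have h1 := hlip ((s - x j) / a) ((s - y) / a)
  rw [← sub_div, abs_div, abs_of_pos ha, show s - x j - (s - y) = -(x j - y) by ring,
    abs_neg] at h1
  refine (mul_le_mul_of_nonneg_left h1 (by positivity)).trans (le_of_eq ?_)
  field_simp

lemma exp_integrable_of_bdd (μ : Measure ℝ) [IsProbabilityMeasure μ] (Y : ℝ → ℝ)
    (hY : Measurable Y) (B : ℝ) (hB : ∀ x, |Y x| ≤ B) (l c : ℝ) :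
    Integrable (fun x => Real.exp (l * Y x - c)) μ := by
  refine Integrable.of_bound (by fun_prop) (Real.exp (|l| * B - c)) ?_
  filter_upwards with x
  rw [Real.norm_eq_abs, abs_of_pos (Real.exp_pos _)]
  refine Real.exp_le_exp.mpr (sub_le_sub_right ?_ c)
  calc l * Y x ≤ |l * Y x| := le_abs_self _
    _ = |l| * |Y x| := abs_mul _ _
    _ ≤ |l| * B := by gcongr; exact hB x

lemma abs_dev_bound (μ : Measure ℝ) [IsProbabilityMeasure μ] (Y : ℝ → ℝ)
    (hY : Measurable Y) (B : ℝ) (hB : ∀ x, |Y x| ≤ B) (l D : ℝ) (hl : 0 < l)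
    (h1 : ∫ x, Real.exp (l * Y x - ∫ z, l * Y z ∂μ) ∂μ ≤ D)
    (h2 : ∫ x, Real.exp ((-l) * Y x - ∫ z, (-l) * Y z ∂μ) ∂μ ≤ D) :
    Integrable (fun x => |Y x - ∫ z, Y z ∂μ|) μ ∧ ∫ x, |Y x - ∫ z, Y z ∂μ| ∂μ ≤ 2 * D / l := by
  have hYi : Integrable Y μ := Integrable.of_bound hY.aestronglyMeasurable B
    (Filter.Eventually.of_forall hB)
  have hi : Integrable (fun x => |Y x - ∫ z, Y z ∂μ|) μ := (hYi.sub (integrable_const _)).abs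
  refine ⟨hi, ?_⟩
  rw [le_div_iff₀ hl, mul_comm, ← integral_const_mul]
  have e1 := exp_integrable_of_bdd μ Y hY B hB l (∫ z, l * Y z ∂μ)
  have e2 := exp_integrable_of_bdd μ Y hY B hB (-l) (∫ z, (-l) * Y z ∂μ)
  calc ∫ x, l * |Y x - ∫ z, Y z ∂μ| ∂μ
      ≤ ∫ x, (Real.exp (l * Y x - ∫ z, l * Y z ∂μ)
          + Real.exp ((-l) * Y x - ∫ z, (-l) * Y z ∂μ)) ∂μ := by
        refine integral_mono (hi.const_mul l) (e1.add e2) ?_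
        intro x
        simp only [integral_const_mul]
        set w := Y x - ∫ z, Y z ∂μ with hw
        rw [show l * Y x - l * ∫ z, Y z ∂μ = l * w by rw [hw]; ring,
          show -l * Y x - -l * ∫ z, Y z ∂μ = -(l * w) by rw [hw]; ring]
        have p1 := Real.add_one_le_exp (l * w)
        have p2 := Real.add_one_le_exp (-(l * w))
        have p3 := Real.exp_pos (l * w)
        have p4 := Real.exp_pos (-(l * w))
        rcases abs_cases w with ⟨hh, _⟩ | ⟨hh, _⟩ <;> rw [hh] <;> linarith
    _ ≤ 2 * D := by
        rw [integral_add e1 e2]; linarith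

/-- Smoothed density. -/
def gE (ψ : ℝ → ℝ) (μ : Measure ℝ) (a : ℝ) (s : ℝ) : ℝ :=
  (1 / a) * ∫ y, ψ ((s - y) / a) ∂μ

lemma gE_measurable (ψ : ℝ → ℝ) (hψm : Measurable ψ) (μ : Measure ℝ) [IsProbabilityMeasure μ]
    (a : ℝ) : Measurable (gE ψ μ a) := by
  unfold gE
  refine Measurable.const_mul ?_ _
  have : StronglyMeasurable (Function.uncurry fun s y : ℝ => ψ ((s - y) / a)) :=
    Measurable.stronglyMeasurable (by unfold Function.uncurry; fun_prop)
  exact this.integral_prod_right.measurable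

lemma gE_eq (ψ h : ℝ → ℝ) (hh_meas : Measurable h) (hh0 : ∀ s, 0 ≤ h s)
    (μ : Measure ℝ) (hdens : μ = volume.withDensity fun s => ENNReal.ofReal (h s))
    (a : ℝ) (ha : 0 < a) (s : ℝ) :
    gE ψ μ a s = ∫ u, ψ u * h (s - a * u) := by
  unfold gE
  rw [hdens, integral_withDensity_eq_integral_toReal_smul (by fun_prop) (by simp)]
  simp only [ENNReal.toReal_ofReal (hh0 _), smul_eq_mul]
  have e1 := integral_sub_left_eq_self (fun y => h y * ψ ((s - y) / a)) volume s
  rw [← e1]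
  simp only [sub_sub_cancel]
  have e2 := Measure.integral_comp_mul_left (fun y => h (s - y) * ψ (y / a)) a
  have e3 : ∀ u, a * u / a = u := fun u => by field_simp
  simp only [e3] at e2
  rw [abs_of_pos (inv_pos.mpr ha), smul_eq_mul] at e2
  rw [one_div, ← e2]
  simp only [mul_comm]

lemma bias_bound (ψ h : ℝ → ℝ) (hψc : Continuous ψ) (hψ0 : ∀ s, 0 ≤ ψ s) (hψi : Integrable ψ)
    (hψ1 : ∫ s, ψ s = 1) (B : ℝ) (hB : ∀ s, ‖ψ s‖ ≤ B)
    (hh_meas : Measurable h) (hh0 : ∀ s, 0 ≤ h s) (hhi : Integrable h)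
    (μ : Measure ℝ) (hdens : μ = volume.withDensity fun s => ENNReal.ofReal (h s))
    (R : ℝ) (hR : 0 < R) (hsupp : ∀ u, R < |u| → ψ u = 0)
    (C' β : ℝ) (hC' : 0 < C') (hβ : 0 < β)
    (hreg : ∀ σ : ℝ, (∫ s, |h s - h (s - σ)|) ≤ C' * |σ| ^ β)
    (a : ℝ) (ha : 0 < a) :
    ∫⁻ s, ‖gE ψ μ a s - h s‖ₑ ≤ ENNReal.ofReal (C' * R ^ β * a ^ β) := by
  have hpt : ∀ s, gE ψ μ a s - h s = ∫ u, ψ u * (h (s - a * u) - h s) := by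
    intro s
    rw [gE_eq ψ h hh_meas hh0 μ hdens a ha s]
    have i1 : Integrable (fun u => ψ u * h (s - a * u)) := by
      refine Integrable.bdd_mul (c := B) ?_ hψc.aestronglyMeasurable
        (Filter.Eventually.of_forall hB)
      exact (hhi.comp_sub_left s).comp_mul_left' ha.ne'
    have i2 : Integrable (fun u => ψ u * h s) := hψi.mul_const _
    simp only [mul_sub]
    rw [integral_sub i1 i2, integral_mul_const, hψ1, one_mul]
  have hψm : Measurable ψ := hψc.measurable
  calc ∫⁻ s, ‖gE ψ μ a s - h s‖ₑ
      ≤ ∫⁻ s, ∫⁻ u, ‖ψ u * (h (s - a * u) - h s)‖ₑ := by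
        refine lintegral_mono (fun s => ?_)
        rw [hpt]
        exact enorm_integral_le_lintegral_enorm _
    _ = ∫⁻ u, ∫⁻ s, ‖ψ u * (h (s - a * u) - h s)‖ₑ := by
        refine lintegral_lintegral_swap ?_
        apply Measurable.aemeasurable
        unfold Function.uncurry
        fun_prop
    _ ≤ ∫⁻ u, ENNReal.ofReal (ψ u) * ENNReal.ofReal (C' * R ^ β * a ^ β) := by
        refine lintegral_mono (fun u => ?_)
        by_cases hu : R < |u|
        · simp [hsupp u hu]
        · push Not at hu
          simp only [enorm_mul]
          rw [lintegral_const_mul _ (by fun_prop), Real.enorm_of_nonneg (hψ0 u)]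
          gcongr
          have hi : Integrable (fun s => h (s - a * u) - h s) := (hhi.comp_sub_right _).sub hhi
          rw [← ofReal_integral_norm_eq_lintegral_enorm hi]
          apply ENNReal.ofReal_le_ofReal
          calc ∫ s, ‖h (s - a * u) - h s‖ = ∫ s, |h s - h (s - a * u)| := by
                simp only [Real.norm_eq_abs, abs_sub_comm]
            _ ≤ C' * |a * u| ^ β := hreg _
            _ ≤ C' * (a * R) ^ β := by
                rw [abs_mul, abs_of_pos ha]
                gcongr
            _ = C' * R ^ β * a ^ β := by
                rw [Real.mul_rpow ha.le hR.le]; ring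
    _ = ENNReal.ofReal (C' * R ^ β * a ^ β) := by
        rw [lintegral_mul_const _ (by fun_prop),
          ← ofReal_integral_eq_lintegral_ofReal hψi (Filter.Eventually.of_forall hψ0), hψ1]
        simp

/-- The orbit segment. -/
def orbE (T : ℝ → ℝ) (n : ℕ) (x : ℝ) : Fin n → ℝ := fun i => T^[(i : ℕ)] x

lemma hatE_orb_measurable (ψ : ℝ → ℝ) (hψm : Measurable ψ) (T : ℝ → ℝ) (hT : Measurable T)
    (n : ℕ) (a : ℝ) :
    Measurable (fun p : ℝ × ℝ => hatE ψ n a (orbE T n p.1) p.2) := by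
  unfold hatE orbE
  refine Measurable.const_mul (Finset.measurable_sum _ (fun j _ => ?_)) _
  have := hT.iterate (j : ℕ)
  fun_prop

lemma hatE_bdd (ψ : ℝ → ℝ) (B : ℝ) (hB : ∀ s, ‖ψ s‖ ≤ B) (n : ℕ) (a : ℝ) (ha : 0 < a)
    (x : Fin n → ℝ) (s : ℝ) : |hatE ψ n a x s| ≤ (1 / (n * a)) * (n * B) := by
  unfold hatE
  rw [abs_mul, abs_of_nonneg (show (0 : ℝ) ≤ 1 / (n * a) by positivity)]
  gcongr
  refine (Finset.abs_sum_le_sum_abs _ _).trans ?_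
  refine (Finset.sum_le_sum (fun j _ => hB _)).trans ?_
  simp

lemma hatE_mean (ψ : ℝ → ℝ) (hψm : Measurable ψ) (B : ℝ) (hB : ∀ s, ‖ψ s‖ ≤ B)
    (T : ℝ → ℝ) (hT : Measurable T) (μ : Measure ℝ) [IsProbabilityMeasure μ]
    (hinv : μ.map T = μ) (n : ℕ) (hn : 1 ≤ n) (a : ℝ) (s : ℝ) :
    ∫ x, hatE ψ n a (orbE T n x) s ∂μ = gE ψ μ a s := by
  have hmp : MeasurePreserving T μ μ := ⟨hT, hinv⟩
  unfold hatE orbE gE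
  have hn' : (n : ℝ) ≠ 0 := by positivity
  rw [integral_const_mul, integral_finsetSum]
  · have : ∀ j : Fin n, ∫ x, ψ ((s - T^[(j : ℕ)] x) / a) ∂μ = ∫ y, ψ ((s - y) / a) ∂μ := by
      intro j
      have hj := hmp.iterate (j : ℕ)
      conv_rhs => rw [← hj.map_eq]
      rw [integral_map hj.measurable.aemeasurable]
      exact Measurable.aestronglyMeasurable (by fun_prop)
    simp only [this]
    simp
    field_simp
  · intro j _
    have := hT.iterate (j : ℕ)
    exact Integrable.of_bound (Measurable.aestronglyMeasurable (by fun_prop)) B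
      (Filter.Eventually.of_forall (fun x => hB _))

lemma mean_bound (ψ h : ℝ → ℝ) (hψm : Measurable ψ) (hψi : Integrable ψ)
    (hh_meas : Measurable h) (hhi : Integrable h)
    (T : ℝ → ℝ) (hT : Measurable T) (X : Set ℝ) (hTX : Set.MapsTo T X X)
    (μ : Measure ℝ) [IsProbabilityMeasure μ] (hX : ∀ᵐ x ∂μ, x ∈ X)
    (M : ℝ) (hM0 : 0 ≤ M) (hM : ∀ x ∈ X, |x| ≤ M)
    (R : ℝ) (hR : 0 < R) (hsupp : ∀ u, R < |u| → ψ u = 0)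
    (n : ℕ) (a : ℝ) (ha : 0 < a) (ha1 : a ≤ 1) (D b : ℝ) (hD : 0 ≤ D) (hb : 0 ≤ b)
    (hbias : ∫⁻ s, ‖gE ψ μ a s - h s‖ₑ ≤ ENNReal.ofReal b)
    (hdi : ∀ s, Integrable (fun x => |hatE ψ n a (orbE T n x) s - gE ψ μ a s|) μ)
    (hdev : ∀ s, ∫ x, |hatE ψ n a (orbE T n x) s - gE ψ μ a s| ∂μ ≤ D) :
    ∫ x, KE ψ h n a (orbE T n x) ∂μ ≤ D * (2 * (M + R)) + b := by
  have hgm := gE_measurable ψ hψm μ a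
  have hhm := hatE_orb_measurable ψ hψm T hT n a
  have hsub : Measurable (fun p : ℝ × ℝ => hatE ψ n a (orbE T n p.1) p.2 - gE ψ μ a p.2) :=
    hhm.sub (hgm.comp measurable_snd)
  have hzero : ∀ s, s ∉ Set.Icc (-(M + R)) (M + R) → ∀ x ∈ X, ψ ((s - x) / a) = 0 := by
    intro s hs x hx
    apply hsupp
    rw [abs_div, abs_of_pos ha, lt_div_iff₀ ha]
    by_contra hcon
    push Not at hcon
    have h1 := abs_le.mp hcon
    have h2 := abs_le.mp (hM x hx)
    exact hs ⟨by nlinarith, by nlinarith⟩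
  have horb : ∀ x ∈ X, ∀ j : ℕ, T^[j] x ∈ X := fun x hx j => hTX.iterate j hx
  have hvar : ∫⁻ x, ∫⁻ s, ‖hatE ψ n a (orbE T n x) s - gE ψ μ a s‖ₑ ∂volume ∂μ
      ≤ ENNReal.ofReal (D * (2 * (M + R))) := by
    rw [lintegral_lintegral_swap hsub.enorm.aemeasurable]
    calc ∫⁻ s, ∫⁻ x, ‖hatE ψ n a (orbE T n x) s - gE ψ μ a s‖ₑ ∂μ
        ≤ ∫⁻ s, (Set.Icc (-(M + R)) (M + R)).indicator (fun _ => ENNReal.ofReal D) s := by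
          refine lintegral_mono (fun s => ?_)
          by_cases hs : s ∈ Set.Icc (-(M + R)) (M + R)
          · rw [Set.indicator_of_mem hs]
            have := ofReal_integral_eq_lintegral_ofReal (hdi s)
              (Filter.Eventually.of_forall (fun _ => abs_nonneg _))
            simp only [← ofReal_norm, Real.norm_eq_abs]
            rw [← this]
            exact ENNReal.ofReal_le_ofReal (hdev s)
          · rw [Set.indicator_of_notMem hs]
            have hg0 : gE ψ μ a s = 0 := by
              unfold gE
              rw [integral_eq_zero_of_ae, mul_zero]
              filter_upwards [hX] with x hx
              exact hzero s hs x hx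
            rw [lintegral_eq_zero_of_ae_eq_zero]
            filter_upwards [hX] with x hx
            have : hatE ψ n a (orbE T n x) s = 0 := by
              unfold hatE orbE
              rw [Finset.sum_eq_zero, mul_zero]
              intro j _
              exact hzero s hs _ (horb x hx j)
            simp [this, hg0]
      _ = ENNReal.ofReal (D * (2 * (M + R))) := by
          rw [lintegral_indicator measurableSet_Icc, setLIntegral_const, Real.volume_Icc,
            ← ENNReal.ofReal_mul hD]
          congr 1
          ring
  have hKm : Measurable (fun x => KE ψ h n a (orbE T n x)) := by
    have : StronglyMeasurable
        (Function.uncurry fun x s : ℝ => |hatE ψ n a (orbE T n x) s - h s|) :=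
      Measurable.stronglyMeasurable (by
        unfold Function.uncurry
        exact (hhm.sub (hh_meas.comp measurable_snd)).abs)
    exact this.integral_prod_right.measurable
  rw [integral_eq_lintegral_of_nonneg_ae (Filter.Eventually.of_forall
    (fun x => KE_nonneg ψ h n a _)) hKm.aestronglyMeasurable]
  refine ENNReal.toReal_le_of_le_ofReal (by positivity) ?_
  calc ∫⁻ x, ENNReal.ofReal (KE ψ h n a (orbE T n x)) ∂μ
      ≤ ∫⁻ x, ((∫⁻ s, ‖hatE ψ n a (orbE T n x) s - gE ψ μ a s‖ₑ) + ENNReal.ofReal b) ∂μ := by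
        refine lintegral_mono (fun x => ?_)
        have hi : Integrable (fun s => hatE ψ n a (orbE T n x) s - h s) :=
          (hatE_integrable ψ hψi n a ha _).sub hhi
        have e := ofReal_integral_norm_eq_lintegral_enorm hi
        simp only [Real.norm_eq_abs] at e
        unfold KE
        rw [e]
        refine le_trans ?_ (add_le_add le_rfl hbias)
        have hm1 : Measurable (fun s => ‖hatE ψ n a (orbE T n x) s - gE ψ μ a s‖ₑ) :=
          (hsub.comp measurable_prodMk_left).enorm
        rw [← lintegral_add_left hm1]
        refine lintegral_mono (fun s => ?_)
        calc ‖hatE ψ n a (orbE T n x) s - h s‖ₑ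
            = ‖(hatE ψ n a (orbE T n x) s - gE ψ μ a s) + (gE ψ μ a s - h s)‖ₑ := by
              congr 1; ring
          _ ≤ _ := enorm_add_le _ _
    _ ≤ ENNReal.ofReal (D * (2 * (M + R)) + b) := by
        rw [lintegral_add_right _ measurable_const, ENNReal.ofReal_add (by positivity) hb]
        simp only [lintegral_const, measure_univ, mul_one]
        gcongr

lemma chernoff (μ : Measure ℝ) [IsProbabilityMeasure μ] (Y : ℝ → ℝ)
    (hY : Measurable Y) (B : ℝ) (hB : ∀ x, |Y x| ≤ B) (t l V : ℝ) (hl : 0 ≤ l)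
    (hm : ∫ x, Y x ∂μ ≤ t / 2)
    (h1 : ∫ x, Real.exp (l * Y x - ∫ z, l * Y z ∂μ) ∂μ ≤ Real.exp V) :
    (μ {x | t < Y x}).toReal ≤ Real.exp (V - l * (t / 2)) := by
  have hi := exp_integrable_of_bdd μ Y hY B hB l (∫ z, l * Y z ∂μ)
  have hmk := mul_meas_ge_le_integral_of_nonneg
    (Filter.Eventually.of_forall (fun x => (Real.exp_pos (l * Y x - ∫ z, l * Y z ∂μ)).le)) hi
    (Real.exp (l * (t / 2)))
  have hsub : μ.real {x | t < Y x}
      ≤ μ.real {x | Real.exp (l * (t / 2)) ≤ Real.exp (l * Y x - ∫ z, l * Y z ∂μ)} := by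
    refine measureReal_mono ?_
    intro x hx
    simp only [Set.mem_ofPred_eq] at hx ⊢
    rw [Real.exp_le_exp, integral_const_mul, ← mul_sub]
    exact mul_le_mul_of_nonneg_left (by linarith) hl
  change μ.real {x | t < Y x} ≤ _
  rw [Real.exp_sub, le_div_iff₀ (Real.exp_pos _), mul_comm]
  calc _ ≤ _ := mul_le_mul_of_nonneg_left hsub (Real.exp_pos _).le
    _ ≤ _ := hmk
    _ ≤ _ := h1

lemma final_opt (n : ℕ) (hn0 : (0 : ℝ) < n) (a : ℝ) (ha : 0 < a) (t : ℝ) (htpos : 0 < t)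
    (C : ℝ) (hC : 0 < C) (R : ℝ) (hR : 0 < R) (Lψ : ℝ) (hLpos : 0 < Lψ) (h8 : a * (8 * R) ≤ 1)
    (P : ℝ) (hfin : ∀ l : ℝ, 0 ≤ l →
      P ≤ Real.exp (C * ∑ _j : Fin n, (l * (4 * R * Lψ / (n * a))) ^ 2 - l * (t / 2))) :
    P ≤ Real.exp (-((n : ℝ) * a ^ 4 * t ^ 2) / (4 * C * Lψ ^ 2)) := by
  -- Chernoff bound
  set l : ℝ := t * (n * a ^ 2) / (4 * C * (4 * R * Lψ) ^ 2) with hl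
  have hlp : 0 < l := by positivity
  refine (hfin l hlp.le).trans (Real.exp_le_exp.mpr ?_)
  rw [Finset.sum_const, Finset.card_univ, Fintype.card_fin, nsmul_eq_mul]
  have e1 : C * ((n : ℝ) * (l * (4 * R * Lψ / (n * a))) ^ 2) - l * (t / 2)
      = -(t ^ 2 * (n * a ^ 2) / (16 * C * (4 * R * Lψ) ^ 2)) := by
    rw [hl]
    field_simp
    ring
  rw [e1, neg_div, neg_le_neg_iff, div_le_div_iff₀ (by positivity) (by positivity)]
  have h64 : (a * (8 * R)) ^ 2 ≤ 1 := by
    have : 0 ≤ a * (8 * R) := by positivity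
    nlinarith
  have hpos : 0 ≤ (n : ℝ) * a ^ 2 * t ^ 2 * (4 * C * Lψ ^ 2) := by positivity
  have := mul_le_mul_of_nonneg_left h64 hpos
  calc _ = (n : ℝ) * a ^ 2 * t ^ 2 * (4 * C * Lψ ^ 2) * (a * (8 * R)) ^ 2 := by ring
    _ ≤ _ := this
    _ = _ := by ring

/-- `L¹` deviation bound for the kernel density estimator
`ĥ_n(x;s) = (1/(n αₙ)) ∑_{j<n} ψ((s - T^j x)/αₙ)`, for a system satisfying the
exponential concentration inequality. -/
theorem kernel_density_estimator_exponential
    (X : Set ℝ) (hXb : Bornology.IsBounded X) (hXm : MeasurableSet X)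
    (T : ℝ → ℝ) (hT : Measurable T) (hTX : Set.MapsTo T X X)
    (μ : Measure ℝ) [IsProbabilityMeasure μ] (hμX : μ X = 1) (hinv : μ.map T = μ)
    (h : ℝ → ℝ) (hh_meas : Measurable h) (hh_nonneg : ∀ s, 0 ≤ h s)
    (hdens : μ = MeasureTheory.volume.withDensity fun s => ENNReal.ofReal (h s))
    (C' β : ℝ) (hC' : 0 < C') (hβ : 0 < β)
    (hreg : ∀ σ : ℝ, (∫ s, |h s - h (s - σ)|) ≤ C' * |σ| ^ β)
    (C : ℝ) (hC : 0 < C)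
    (hconc : ∀ (n : ℕ), 1 ≤ n → ∀ (K : (Fin n → ℝ) → ℝ) (L : Fin n → ℝ), SepLip K L →
      ∫ x, Real.exp (K (fun i => T^[(i : ℕ)] x)
          - ∫ z, K (fun i => T^[(i : ℕ)] z) ∂μ) ∂μ
        ≤ Real.exp (C * ∑ j, L j ^ 2))
    (ψ : ℝ → ℝ) (hψ_nonneg : ∀ s, 0 ≤ ψ s) (hψ_supp : HasCompactSupport ψ)
    (Lψ : ℝ) (hLψ : 0 ≤ Lψ) (hψ_lip : ∀ a b : ℝ, |ψ a - ψ b| ≤ Lψ * |a - b|)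
    (hψ_int : (∫ s, ψ s) = 1)
    (α : ℕ → ℝ) (hα : ∀ n, 0 < α n) :
    ∃ Cψ : ℝ, 0 < Cψ ∧ ∀ (n : ℕ), 1 ≤ n → ∀ t : ℝ,
      Cψ * ((α n) ^ β + 1 / (Real.sqrt n * (α n) ^ 2)) < t →
      (μ {x | t < ∫ s, |(1 / ((n : ℝ) * α n))
            * ∑ j ∈ Finset.range n, ψ ((s - T^[j] x) / α n) - h s|}).toReal
        ≤ Real.exp (-((n : ℝ) * (α n) ^ 4 * t ^ 2) / (4 * C * Lψ ^ 2)) := by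
  -- preliminaries
  have hψc : Continuous ψ := by
    have : LipschitzWith ⟨Lψ, hLψ⟩ ψ := LipschitzWith.of_dist_le_mul (fun a b => by
      rw [Real.dist_eq, Real.dist_eq]
      exact hψ_lip a b)
    exact this.continuous
  have hψm : Measurable ψ := hψc.measurable
  have hψi : Integrable ψ := hψc.integrable_of_hasCompactSupport hψ_supp
  obtain ⟨B, hB⟩ := hψ_supp.exists_bound_of_continuous hψc
  obtain ⟨R, hR1, hsupp⟩ : ∃ R : ℝ, 1 ≤ R ∧ ∀ u, R < |u| → ψ u = 0 := by
    obtain ⟨r, hr⟩ := hψ_supp.isCompact.isBounded.exists_norm_le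
    refine ⟨max r 1, le_max_right _ _, fun u hu => ?_⟩
    by_contra hne
    have := hr u (subset_tsupport ψ hne)
    rw [Real.norm_eq_abs] at this
    exact absurd hu (not_lt.mpr (this.trans (le_max_left _ _)))
  have hR : 0 < R := by linarith
  obtain ⟨M, hM0, hM⟩ : ∃ M : ℝ, 0 ≤ M ∧ ∀ x ∈ X, |x| ≤ M := by
    obtain ⟨m, hm⟩ := hXb.exists_norm_le
    exact ⟨max m 0, le_max_right _ _, fun x hx => (hm x hx).trans (le_max_left _ _)⟩
  have hX : ∀ᵐ x ∂μ, x ∈ X := by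
    exact (mem_ae_iff_prob_eq_one hXm).mpr hμX
  have hlint : ∫⁻ s, ENNReal.ofReal (h s) = 1 := by
    have h1 : μ Set.univ = 1 := measure_univ
    rw [hdens, withDensity_apply _ MeasurableSet.univ, Measure.restrict_univ] at h1
    exact h1
  have hhi : Integrable h := by
    refine ⟨hh_meas.aestronglyMeasurable, ?_⟩
    rw [hasFiniteIntegral_iff_ofReal (Filter.Eventually.of_forall hh_nonneg), hlint]
    simp
  have hh1 : ∫ s, h s = 1 := by
    rw [integral_eq_lintegral_of_nonneg_ae (Filter.Eventually.of_forall hh_nonneg)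
      hh_meas.aestronglyMeasurable, hlint]
    simp
  have hprob : ∀ S : Set ℝ, (μ S).toReal ≤ 1 := fun S => by
    have := prob_le_one (μ := μ) (s := S)
    exact ENNReal.toReal_le_of_le_ofReal zero_le_one (by simpa using this)
  rcases hLψ.eq_or_lt with hL0 | hLpos
  · refine ⟨1, one_pos, fun n hn t ht => ?_⟩
    rw [← hL0]
    simpa using hprob _
  set A1 : ℝ := 2 * (C' * R ^ β) with hA1
  set A2 : ℝ := 2 * (2 * Real.exp C * Lψ * (2 * (M + R))) with hA2
  set A3 : ℝ := 2 * (8 * R) ^ β with hA3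
  have p1 : 0 < A1 := by positivity
  have p2 : 0 < A2 := by positivity
  have p3 : 0 < A3 := by positivity
  refine ⟨A1 + A2 + A3, by positivity, fun n hn t ht => ?_⟩
  set a := α n with ha_def
  have ha : 0 < a := hα n
  have hn0 : (0 : ℝ) < n := by exact_mod_cast hn
  have hsn : 0 < Real.sqrt n := Real.sqrt_pos.mpr hn0
  have hq : 0 < 1 / (Real.sqrt n * a ^ 2) := by positivity
  have hab : 0 < a ^ β := Real.rpow_pos_of_pos ha β
  have hset : {x | t < ∫ s, |(1 / ((n : ℝ) * a))
            * ∑ j ∈ Finset.range n, ψ ((s - T^[j] x) / a) - h s|}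
      = {x | t < KE ψ h n a (orbE T n x)} := by
    ext x
    simp only [Set.mem_ofPred_eq, KE, hatE, orbE, Finset.sum_range]
  rw [hset]
  have ht1 : A1 * a ^ β + A2 * (1 / (Real.sqrt n * a ^ 2)) + A3 * a ^ β < t := by
    have q1 := mul_pos p1 hq
    have q2 := mul_pos p2 hab
    have q3 := mul_pos p3 hq
    nlinarith
  have t1 := mul_pos p1 hab
  have t2 := mul_pos p2 hq
  have t3 := mul_pos p3 hab
  have htpos : 0 < t := by linarith
  have hK2 : ∀ x, KE ψ h n a x ≤ 2 :=
    KE_le_two ψ h hψ_nonneg hψi hψ_int hh_nonneg hhi hh1 n hn a ha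
  by_cases hsmall : 1 / (8 * R) < a
  · have h2 : 2 ≤ A3 * a ^ β := by
      rw [hA3, mul_assoc, ← Real.mul_rpow (by positivity) ha.le]
      have : 1 ≤ 8 * R * a := by
        rw [div_lt_iff₀ (by positivity)] at hsmall
        linarith
      have := Real.one_le_rpow this hβ.le
      linarith
    have hem : {x | t < KE ψ h n a (orbE T n x)} = ∅ := by
      ext x
      simp only [Set.mem_ofPred_eq, Set.mem_empty_iff_false, iff_false, not_lt]
      linarith [hK2 (orbE T n x)]
    rw [hem]
    simp [Real.exp_nonneg]
  push Not at hsmall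
  have h8 : a * (8 * R) ≤ 1 := by
    rwa [le_div_iff₀ (by positivity)] at hsmall
  have ha1 : a ≤ 1 := by nlinarith
  -- deviation of the estimator at a fixed point
  have hKm : Measurable (fun x => KE ψ h n a (orbE T n x)) := by
    have : StronglyMeasurable
        (Function.uncurry fun x s : ℝ => |hatE ψ n a (orbE T n x) s - h s|) :=
      Measurable.stronglyMeasurable (by
        unfold Function.uncurry
        exact ((hatE_orb_measurable ψ hψm T hT n a).sub (hh_meas.comp measurable_snd)).abs)
    exact this.integral_prod_right.measurable
  set l0 : ℝ := Real.sqrt n * a ^ 2 / Lψ with hl0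
  have hl0p : 0 < l0 := by positivity
  have hsum : ∀ l : ℝ, |l| = l0 → C * ∑ _j : Fin n, (|l| * (Lψ / (n * a ^ 2))) ^ 2 = C := by
    intro l hl
    rw [hl, Finset.sum_const, Finset.card_univ, Fintype.card_fin, nsmul_eq_mul, hl0]
    have hs : Real.sqrt n ^ 2 = n := Real.sq_sqrt hn0.le
    have : (n : ℝ) * (Real.sqrt n * a ^ 2 / Lψ * (Lψ / (n * a ^ 2))) ^ 2 = 1 := by
      have : Real.sqrt n * a ^ 2 / Lψ * (Lψ / (n * a ^ 2)) = Real.sqrt n / n := by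
        field_simp
      rw [this, div_pow, hs]
      field_simp
    rw [this, mul_one]
  have hdevs : ∀ s, Integrable (fun x => |hatE ψ n a (orbE T n x) s - gE ψ μ a s|) μ ∧
      ∫ x, |hatE ψ n a (orbE T n x) s - gE ψ μ a s| ∂μ ≤ 2 * Real.exp C / l0 := by
    intro s
    rw [← hatE_mean ψ hψm B hB T hT μ hinv n hn a s]
    refine abs_dev_bound μ (fun x => hatE ψ n a (orbE T n x) s) ?_ _
      (fun x => hatE_bdd ψ B hB n a ha _ s) l0 _ hl0p ?_ ?_
    · exact (hatE_orb_measurable ψ hψm T hT n a).comp measurable_prodMk_right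
    · have := hconc n hn _ _ (hatE_sepLip ψ Lψ hψ_lip n a ha l0 s)
      rw [hsum l0 (abs_of_pos hl0p)] at this
      exact this
    · have := hconc n hn _ _ (hatE_sepLip ψ Lψ hψ_lip n a ha (-l0) s)
      rw [hsum (-l0) (by rw [abs_neg, abs_of_pos hl0p])] at this
      exact this
  have hmean := mean_bound ψ h hψm hψi hh_meas hhi T hT X hTX μ hX M hM0 hM R hR hsupp n a ha ha1
    (2 * Real.exp C / l0) (C' * R ^ β * a ^ β) (by positivity) (by positivity)
    (bias_bound ψ h hψc hψ_nonneg hψi hψ_int B hB hh_meas hh_nonneg hhi μ hdens R hR hsupp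
      C' β hC' hβ hreg a ha) (fun s => (hdevs s).1) (fun s => (hdevs s).2)
  have hmean2 : ∫ x, KE ψ h n a (orbE T n x) ∂μ ≤ t / 2 := by
    refine hmean.trans ?_
    have e : 2 * Real.exp C / l0 * (2 * (M + R)) = A2 * (1 / (Real.sqrt n * a ^ 2)) / 2 := by
      rw [hl0, hA2]; field_simp
    rw [e, show C' * R ^ β * a ^ β = A1 * a ^ β / 2 by rw [hA1]; ring]
    linarith
  have hfin : ∀ l : ℝ, 0 ≤ l → (μ {x | t < KE ψ h n a (orbE T n x)}).toReal
      ≤ Real.exp (C * ∑ _j : Fin n, (l * (4 * R * Lψ / (n * a))) ^ 2 - l * (t / 2)) := by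
    intro l hl
    have hc := hconc n hn _ _ (KE_sepLip ψ h hψi hhi R hR hsupp Lψ hLψ hψ_lip n a ha l hl)
    exact chernoff μ (fun x => KE ψ h n a (orbE T n x)) hKm 2
      (fun x => by rw [abs_of_nonneg (KE_nonneg _ _ _ _ _)]; exact hK2 _) t l _ hl hmean2 hc
  clear_value a
  exact final_opt n hn0 a ha t htpos C hC R hR Lψ hLpos h8 _ hfin
end
end

section
/- Let X be a bounded Borel subset of ℝ, T : X → X Borel measurable, and μ a T-invariant probability measure absolutely continuous with density h satisfying ∫ |h(s) − h(s − σ)| ds ≤ C' |σ|^β for some C', β > 0 and all σ ∈ ℝ. Suppose (X,T,μ) satisfies the polynomial concentration inequality with moment q ≥ 2 and constant C_q > 0. Let ψ : ℝ → ℝ be a bounded, non-negative Lipschitz kernel with bounded support and ∫ ψ(s) ds = 1, and let (α_n) be positive reals. Then there exists a constant C_ψ > 0 such that for every n ≥ 1 and every t > C_ψ (α_n^β + 1/(√n α_n²)), μ({x : ∫ |ĥ_n(x; s) − h(s)| ds > t}) ≤ (C_q / t^q) (Lip(ψ)/(√n α_n²))^q, where ĥ_n(x; s) = (1/(n α_n))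 Σ_{j=0}^{n−1} ψ((s − T^j x)/α_n). -/
open MeasureTheory Real

noncomputable section

/-- The kernel estimator. -/
def kde (ψ : ℝ → ℝ) (a : ℝ) (n : ℕ) (y : Fin n → ℝ) (s : ℝ) : ℝ :=
  (1 / ((n : ℝ) * a)) * ∑ j, ψ ((s - y j) / a)

lemma integrable_of_bdd_supp (f : ℝ → ℝ) (hf : AEStronglyMeasurable f volume) (M R : ℝ)
    (hM : ∀ s, |f s| ≤ M) (hR : ∀ s, R < |s| → f s = 0) : Integrable f := by
  have h1 : IntegrableOn f (Set.Icc (-R) R) := by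
    refine Measure.integrableOn_of_bounded (M := M) (by simp) hf ?_
    exact Filter.Eventually.of_forall fun s => by simpa using hM s
  refine (integrableOn_iff_integrable_of_support_subset ?_).1 h1
  intro s hs
  by_contra hc
  apply hs
  apply hR
  by_contra h2
  exact hc (abs_le.1 (not_lt.1 h2))

lemma int_scale (ψ : ℝ → ℝ) (hψ : Integrable ψ) (a : ℝ) (ha : 0 < a) (b : ℝ) :
    Integrable (fun s => ψ ((s - b) / a)) ∧ ∫ s, ψ ((s - b) / a) = a * ∫ s, ψ s := by
  constructor
  · exact (hψ.comp_div ha.ne').comp_sub_right b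
  · rw [integral_sub_right_eq_self (fun s => ψ (s / a)) b, Measure.integral_comp_div,
      abs_of_pos ha, smul_eq_mul]

lemma lip_L1 (ψ : ℝ → ℝ) (hψ : Integrable ψ) (L : ℝ) (hL : 0 ≤ L)
    (hlip : ∀ a b : ℝ, |ψ a - ψ b| ≤ L * |a - b|) (r : ℝ) (hr : 0 < r)
    (hsupp : ∀ s, r < |s| → ψ s = 0) (a : ℝ) (ha : 0 < a) (b c : ℝ) :
    ∫ s, |ψ ((s - b) / a) - ψ ((s - c) / a)| ≤ 4 * r * L * |b - c| := by
  set S : Set ℝ := Set.Icc (b - a * r) (b + a * r) ∪ Set.Icc (c - a * r) (c + a * r) with hS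
  have hz : ∀ s, s ∉ S → |ψ ((s - b) / a) - ψ ((s - c) / a)| = 0 := by
    intro s hs
    simp only [hS, Set.mem_union, not_or] at hs
    have key : ∀ d, s ∉ Set.Icc (d - a * r) (d + a * r) → ψ ((s - d) / a) = 0 := by
      intro d hd
      apply hsupp
      rw [abs_div, abs_of_pos ha, lt_div_iff₀ ha]
      by_contra h2
      have := abs_le.1 (not_lt.1 h2)
      exact hd ⟨by nlinarith, by nlinarith⟩
    rw [key b hs.1, key c hs.2]; simp
  rw [← setIntegral_eq_integral_of_forall_compl_eq_zero hz]
  have hfin : volume S < ⊤ := by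
    refine (measure_union_le _ _).trans_lt ?_
    simp
  have hvol : volume.real S ≤ 4 * a * r := by
    refine (measureReal_union_le _ _).trans ?_
    rw [Real.volume_real_Icc_of_le (by nlinarith [mul_pos ha hr]),
      Real.volume_real_Icc_of_le (by nlinarith [mul_pos ha hr])]
    linarith
  have h1 : ∫ s in S, |ψ ((s - b) / a) - ψ ((s - c) / a)| ≤ ∫ s in S, L * |b - c| / a := by
    refine integral_mono_of_nonneg (Filter.Eventually.of_forall fun _ => abs_nonneg _)
      (integrableOn_const (by exact hfin.ne)) (Filter.Eventually.of_forall fun s => ?_)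
    refine (hlip _ _).trans (le_of_eq ?_)
    rw [← sub_div, abs_div, abs_of_pos ha, abs_sub_comm b c,
      show s - b - (s - c) = c - b by ring]
    ring
  refine h1.trans ?_
  rw [setIntegral_const, smul_eq_mul]
  calc volume.real S * (L * |b - c| / a) ≤ 4 * a * r * (L * |b - c| / a) := by gcongr
    _ = _ := by field_simp

lemma kde_update (ψ : ℝ → ℝ) (a : ℝ) (n : ℕ) (x : Fin n → ℝ) (j : Fin n) (y s : ℝ) :
    kde ψ a n x s - kde ψ a n (Function.update x j y) s
      = (1 / ((n : ℝ) * a)) * (ψ ((s - x j) / a) - ψ ((s - y) / a)) := by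
  unfold kde
  rw [← mul_sub, ← Finset.sum_sub_distrib, Finset.sum_eq_single j]
  · simp
  · intro i _ hi
    simp [Function.update_of_ne hi]
  · simp

lemma kde_integrable (ψ : ℝ → ℝ) (hψ : Integrable ψ) (a : ℝ) (ha : 0 < a) (n : ℕ)
    (x : Fin n → ℝ) : Integrable (kde ψ a n x) := by
  unfold kde
  exact (integrable_finsetSum _ fun j _ => (int_scale ψ hψ a ha _).1).const_mul _

lemma kde_nonneg (ψ : ℝ → ℝ) (hψ : ∀ s, 0 ≤ ψ s) (a : ℝ) (ha : 0 < a) (n : ℕ)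
    (x : Fin n → ℝ) (s : ℝ) : 0 ≤ kde ψ a n x s := by
  unfold kde
  exact mul_nonneg (by positivity) (Finset.sum_nonneg fun _ _ => hψ _)

lemma kde_integral (ψ : ℝ → ℝ) (hψ : Integrable ψ) (h1 : ∫ s, ψ s = 1) (a : ℝ) (ha : 0 < a)
    (n : ℕ) (hn : 1 ≤ n) (x : Fin n → ℝ) : ∫ s, kde ψ a n x s = 1 := by
  unfold kde
  rw [integral_const_mul, integral_finsetSum _ fun j _ => (int_scale ψ hψ a ha _).1]
  simp only [(int_scale ψ hψ a ha _).2, h1]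
  have : (n : ℝ) ≠ 0 := by positivity
  simp
  field_simp

lemma kde_le (ψ : ℝ → ℝ) (M : ℝ) (hM : ∀ s, ψ s ≤ M) (a : ℝ) (ha : 0 < a)
    (n : ℕ) (hn : 1 ≤ n) (x : Fin n → ℝ) (s : ℝ) : kde ψ a n x s ≤ M / a := by
  unfold kde
  have : (0 : ℝ) < n := by positivity
  calc _ ≤ (1 / ((n : ℝ) * a)) * ∑ j : Fin n, M := by
        gcongr; exact hM _
    _ = _ := by simp; field_simp

lemma kde_sepLip (ψ : ℝ → ℝ) (L : ℝ)
    (hlip : ∀ a b : ℝ, |ψ a - ψ b| ≤ L * |a - b|) (a : ℝ) (ha : 0 < a) (n : ℕ) (hn : 1 ≤ n)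
    (s : ℝ) : SepLip (fun x => kde ψ a n x s) (fun _ => L / (n * a ^ 2)) := by
  intro x j y
  have hn' : (0 : ℝ) < n := by positivity
  simp only [kde_update]
  rw [abs_mul, abs_of_pos (by positivity)]
  calc _ ≤ (1 / ((n : ℝ) * a)) * (L * |(s - x j) / a - (s - y) / a|) := by
        gcongr; exact hlip _ _
    _ = _ := by
      rw [← sub_div, abs_div, abs_of_pos ha, Real.dist_eq, abs_sub_comm (x j),
        show s - x j - (s - y) = y - x j by ring]
      field_simp

lemma K_sepLip (ψ : ℝ → ℝ) (hψ : Integrable ψ) (L : ℝ) (hL : 0 ≤ L)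
    (hlip : ∀ a b : ℝ, |ψ a - ψ b| ≤ L * |a - b|) (r : ℝ) (hr : 0 < r)
    (hsupp : ∀ s, r < |s| → ψ s = 0) (a : ℝ) (ha : 0 < a) (n : ℕ) (hn : 1 ≤ n)
    (h : ℝ → ℝ) (hh : Integrable h) :
    SepLip (fun x => ∫ s, |kde ψ a n x s - h s|) (fun _ => 4 * r * L / (n * a)) := by
  intro x j y
  have hn' : (0 : ℝ) < n := by positivity
  have i1 : ∀ x : Fin n → ℝ, Integrable (fun s => |kde ψ a n x s - h s|) :=
    fun x => ((kde_integrable ψ hψ a ha n x).sub hh).abs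
  simp only
  rw [← integral_sub (i1 _) (i1 _)]
  calc _ ≤ ∫ s, |(|kde ψ a n x s - h s| - |kde ψ a n (Function.update x j y) s - h s|)| :=
        abs_integral_le_integral_abs
    _ ≤ ∫ s, (1 / ((n : ℝ) * a)) * |ψ ((s - x j) / a) - ψ ((s - y) / a)| := by
      refine integral_mono ((i1 _).sub (i1 _)).abs
        ((((int_scale ψ hψ a ha _).1.sub (int_scale ψ hψ a ha _).1).abs).const_mul _) ?_
      intro s
      simp only
      refine (abs_abs_sub_abs_le _ _).trans (le_of_eq ?_)
      rw [sub_sub_sub_cancel_right, kde_update, abs_mul, abs_of_pos (by positivity)]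
    _ ≤ (1 / ((n : ℝ) * a)) * (4 * r * L * |x j - y|) := by
      rw [integral_const_mul]
      gcongr
      exact lip_L1 ψ hψ L hL hlip r hr hsupp a ha _ _
    _ = _ := by
      rw [Real.dist_eq]; field_simp

lemma K_le_two (ψ : ℝ → ℝ) (hψ : Integrable ψ) (hψ0 : ∀ s, 0 ≤ ψ s) (h1 : ∫ s, ψ s = 1)
    (a : ℝ) (ha : 0 < a) (n : ℕ) (hn : 1 ≤ n)
    (h : ℝ → ℝ) (hh : Integrable h) (hh0 : ∀ s, 0 ≤ h s) (hh1 : ∫ s, h s = 1) (x : Fin n → ℝ) :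
    ∫ s, |kde ψ a n x s - h s| ≤ 2 := by
  have i := kde_integrable ψ hψ a ha n x
  calc _ ≤ ∫ s, (kde ψ a n x s + h s) := by
        refine integral_mono (i.sub hh).abs (i.add hh) fun s => ?_
        have := kde_nonneg ψ hψ0 a ha n x s
        simp only
        rw [abs_le]; constructor <;> linarith [hh0 s]
    _ = 2 := by
      rw [integral_add i hh, hh1, kde_integral ψ hψ h1 a ha n hn x]; norm_num

lemma bias (ψ : ℝ → ℝ) (hψ : Integrable ψ) (hψm : Continuous ψ) (hψ0 : ∀ s, 0 ≤ ψ s)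
    (h1 : ∫ s, ψ s = 1) (M : ℝ) (hM : ∀ s, ψ s ≤ M)
    (r : ℝ) (hr : 0 < r) (hsupp : ∀ s, r < |s| → ψ s = 0)
    (a : ℝ) (ha : 0 < a)
    (h : ℝ → ℝ) (hm : Measurable h) (hh : Integrable h) (hh0 : ∀ s, 0 ≤ h s) (hh1 : ∫ s, h s = 1)
    (C' β : ℝ) (hC' : 0 < C') (hβ : 0 < β)
    (hreg : ∀ σ : ℝ, (∫ s, |h s - h (s - σ)|) ≤ C' * |σ| ^ β) :
    ∫ s, |(1 / a) * (∫ z, ψ ((s - z) / a) * h z) - h s| ≤ C' * (a * r) ^ β := by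
  have e1 : ∀ s, (1 / a) * (∫ z, ψ ((s - z) / a) * h z) = ∫ u, ψ u * h (s - a * u) := by
    intro s
    have := Measure.integral_comp_mul_left (fun v => ψ (v / a) * h (s - v)) a
    simp only [mul_div_cancel_left₀ _ ha.ne'] at this
    rw [this, abs_of_pos (by positivity), smul_eq_mul,
      ← integral_sub_left_eq_self (fun z => ψ ((s - z) / a) * h z) volume s]
    simp
  have ihs : ∀ s, Integrable (fun u => h (s - a * u)) := by
    intro s
    exact (hh.comp_sub_left s).comp_mul_left' ha.ne'
  have ips : ∀ s, Integrable (fun u => ψ u * h (s - a * u)) := by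
    intro s
    refine (ihs s).bdd_mul (c := M) hψm.aestronglyMeasurable ?_
    exact Filter.Eventually.of_forall fun u => by
      rw [Real.norm_eq_abs, abs_of_nonneg (hψ0 u)]; exact hM u
  have ihd : ∀ v, Integrable (fun s => |h s - h (s - v)|) := fun v =>
    (hh.sub (hh.comp_sub_right v)).abs
  have e2 : ∀ s, |(1 / a) * (∫ z, ψ ((s - z) / a) * h z) - h s|
      ≤ ∫ u, ψ u * |h s - h (s - a * u)| := by
    intro s
    have : (1 / a) * (∫ z, ψ ((s - z) / a) * h z) - h s
        = ∫ u, (ψ u * h (s - a * u) - ψ u * h s) := by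
      rw [integral_sub (ips s) (hψ.mul_const _), integral_mul_const, h1, e1, one_mul]
    rw [this]
    refine abs_integral_le_integral_abs.trans (le_of_eq ?_)
    congr 1; ext u
    rw [← mul_sub, abs_mul, abs_of_nonneg (hψ0 u), abs_sub_comm]
  have b2 : ∀ v, ∫ s, |h s - h (s - v)| ≤ 2 := by
    intro v
    calc _ ≤ ∫ s, (h s + h (s - v)) := by
          refine integral_mono (ihd v) (hh.add (hh.comp_sub_right v)) fun s => ?_
          simp only
          rw [abs_le]; constructor <;> linarith [hh0 s, hh0 (s - v)]
      _ = 2 := by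
        rw [integral_add hh (hh.comp_sub_right v), integral_sub_right_eq_self h v, hh1]; norm_num
  have mF : Measurable (fun p : ℝ × ℝ => ψ p.2 * |h p.1 - h (p.1 - a * p.2)|) := by
    have := hψm.measurable
    fun_prop
  have iF : Integrable (fun p : ℝ × ℝ => ψ p.2 * |h p.1 - h (p.1 - a * p.2)|)
      (volume.prod volume) := by
    rw [integrable_prod_iff' mF.aestronglyMeasurable]
    constructor
    · exact Filter.Eventually.of_forall fun u => (ihd (a * u)).const_mul (ψ u)
    · refine (hψ.const_mul 2).mono' ?_ ?_
      · exact mF.norm.stronglyMeasurable.integral_prod_left'.aestronglyMeasurable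
      · refine Filter.Eventually.of_forall fun u => ?_
        simp only [norm_mul, Real.norm_eq_abs, abs_abs, abs_of_nonneg (hψ0 u)]
        rw [integral_const_mul, abs_mul, abs_of_nonneg (hψ0 u),
          abs_of_nonneg (integral_nonneg fun _ => abs_nonneg _), mul_comm]
        exact mul_le_mul_of_nonneg_right (b2 _) (hψ0 u)
  calc _ ≤ ∫ s, ∫ u, ψ u * |h s - h (s - a * u)| :=
        integral_mono_of_nonneg (Filter.Eventually.of_forall fun _ => abs_nonneg _)
          iF.integral_prod_left (Filter.Eventually.of_forall e2)
    _ = ∫ u, ∫ s, ψ u * |h s - h (s - a * u)| := integral_integral_swap iF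
    _ ≤ ∫ u, ψ u * (C' * (a * r) ^ β) := by
      refine integral_mono iF.integral_prod_right (hψ.mul_const _) fun u => ?_
      simp only
      rw [integral_const_mul]
      by_cases hu : r < |u|
      · simp [hsupp u hu]
      · refine mul_le_mul_of_nonneg_left ((hreg _).trans ?_) (hψ0 u)
        rw [abs_mul, abs_of_pos ha]
        have := not_lt.1 hu
        gcongr
    _ = _ := by rw [integral_mul_const, h1, one_mul]

lemma rpow_young (y A q : ℝ) (hy : 0 ≤ y) (hA : 0 < A) (hq : 2 ≤ q) :
    y ≤ A + A * (y ^ q / A ^ q) := by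
  rw [← Real.div_rpow hy hA.le]
  by_cases h : y ≤ A
  · have : 0 ≤ (y / A) ^ q := by positivity
    nlinarith
  · have h1 : 1 ≤ y / A := by rw [le_div_iff₀ hA]; linarith
    have h2 : y / A ≤ (y / A) ^ q := by
      simpa using Real.rpow_le_rpow_of_exponent_le h1 (show (1 : ℝ) ≤ q by linarith)
    have h3 : A * (y / A) = y := by field_simp
    nlinarith

lemma sum_const_rpow (n : ℕ) (hn : 1 ≤ n) (c B q : ℝ) (hB : 0 ≤ B) (hc : 0 < c) :
    (∑ _j : Fin n, (B / (n * c)) ^ 2) ^ (q / 2) = (B / (√n * c)) ^ q := by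
  have hn' : (0 : ℝ) < n := by positivity
  have : (∑ _j : Fin n, (B / (n * c)) ^ 2) = (B / (√n * c)) ^ (2 : ℝ) := by
    rw [Real.rpow_two]
    simp only [Finset.sum_const, Finset.card_univ, Fintype.card_fin, nsmul_eq_mul]
    rw [div_pow, div_pow, mul_pow, mul_pow, Real.sq_sqrt hn'.le]
    field_simp
  rw [this, ← Real.rpow_mul (by positivity)]
  congr 1; ring

lemma kde_meas (T : ℝ → ℝ) (hT : Measurable T)
    (ψ : ℝ → ℝ) (hψm : Continuous ψ) (a : ℝ) (n : ℕ) :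
    Measurable (fun p : ℝ × ℝ => kde ψ a n (fun i => T^[(i : ℕ)] p.1) p.2) := by
  unfold kde
  have := hψm.measurable
  have h2 : ∀ i : ℕ, Measurable (T^[i]) := fun i => hT.iterate i
  fun_prop

/-- The mean of the kernel estimator. -/
lemma kde_mean (T : ℝ → ℝ) (hT : Measurable T)
    (μ : Measure ℝ) [IsProbabilityMeasure μ] (hinv : μ.map T = μ)
    (ψ : ℝ → ℝ) (hψm : Continuous ψ) (hψ0 : ∀ s, 0 ≤ ψ s)
    (M : ℝ) (hM : ∀ s, ψ s ≤ M) (a : ℝ) (ha : 0 < a) (n : ℕ) (hn : 1 ≤ n)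
    (h : ℝ → ℝ) (hm : Measurable h) (hh0 : ∀ s, 0 ≤ h s)
    (hdens : μ = MeasureTheory.volume.withDensity fun s => ENNReal.ofReal (h s)) (s : ℝ) :
    ∫ x, kde ψ a n (fun i => T^[(i : ℕ)] x) s ∂μ
      = (1 / a) * (∫ z, ψ ((s - z) / a) * h z) := by
  have hn' : (0 : ℝ) < n := by positivity
  have mp : MeasurePreserving T μ μ := ⟨hT, hinv⟩
  have hψm' := hψm.measurable
  have mψ : Measurable (fun z => ψ ((s - z) / a)) := by fun_prop
  have e : ∀ j : ℕ, ∫ x, ψ ((s - T^[j] x) / a) ∂μ = ∫ z, ψ ((s - z) / a) * h z := by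
    intro j
    have e1 : ∫ x, ψ ((s - T^[j] x) / a) ∂μ = ∫ x, ψ ((s - x) / a) ∂μ := by
      have := (mp.iterate j).map_eq
      conv_rhs => rw [← this]
      rw [integral_map (hT.iterate j).aemeasurable mψ.aestronglyMeasurable]
    rw [e1, hdens, integral_withDensity_eq_integral_toReal_smul (by fun_prop) (by simp)]
    congr 1; ext z
    rw [ENNReal.toReal_ofReal (hh0 z), smul_eq_mul, mul_comm]
  unfold kde
  rw [integral_const_mul, integral_finsetSum]
  · simp only [e]
    simp
    field_simp
  · intro i _
    refine Integrable.of_bound (C := M) (mψ.comp (hT.iterate i)).aestronglyMeasurable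
      (Filter.Eventually.of_forall fun x => ?_)
    simp only [Real.norm_eq_abs, Function.comp]
    rw [abs_of_nonneg (hψ0 _)]; exact hM _

lemma fluct_point (T : ℝ → ℝ) (hT : Measurable T)
    (μ : Measure ℝ) [IsProbabilityMeasure μ]
    (q : ℝ) (hq : 2 ≤ q) (Cq : ℝ) (hCq : 0 < Cq)
    (hconc : ∀ (n : ℕ), 1 ≤ n → ∀ (K : (Fin n → ℝ) → ℝ) (L : Fin n → ℝ), SepLip K L →
      ∫ x, |K (fun i => T^[(i : ℕ)] x)
          - ∫ z, K (fun i => T^[(i : ℕ)] z) ∂μ| ^ q ∂μ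
        ≤ Cq * (∑ j, L j ^ 2) ^ (q / 2))
    (ψ : ℝ → ℝ) (hψm : Continuous ψ) (hψ0 : ∀ s, 0 ≤ ψ s)
    (M : ℝ) (hM : ∀ s, ψ s ≤ M) (L : ℝ) (hL : 0 ≤ L)
    (hlip : ∀ a b : ℝ, |ψ a - ψ b| ≤ L * |a - b|)
    (a : ℝ) (ha : 0 < a) (n : ℕ) (hn : 1 ≤ n) (s : ℝ) :
    ∫ x, |kde ψ a n (fun i => T^[(i : ℕ)] x) s
      - ∫ z, kde ψ a n (fun i => T^[(i : ℕ)] z) s ∂μ| ∂μ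
      ≤ (1 + Cq) * ((L + 1) * (1 / (√n * a ^ 2))) := by
  have hn' : (0 : ℝ) < n := by positivity
  set m := ∫ z, kde ψ a n (fun i => T^[(i : ℕ)] z) s ∂μ with hmdef
  set A := (L + 1) * (1 / (√n * a ^ 2)) with hA
  have hA0 : 0 < A := by positivity
  have mk : Measurable (fun x => kde ψ a n (fun i => T^[(i : ℕ)] x) s) :=
    (kde_meas T hT ψ hψm a n).comp (measurable_id.prodMk measurable_const)
  have hb : ∀ x, |kde ψ a n (fun i => T^[(i : ℕ)] x) s - m| ≤ M / a + |m| := by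
    intro x
    refine (abs_sub _ _).trans ?_
    rw [abs_of_nonneg (kde_nonneg ψ hψ0 a ha n _ s)]
    gcongr
    exact kde_le ψ M hM a ha n hn _ s
  have i1 : Integrable (fun x => |kde ψ a n (fun i => T^[(i : ℕ)] x) s - m|) μ := by
    refine Integrable.of_bound (C := M / a + |m|) (mk.sub_const m).abs.aestronglyMeasurable
      (Filter.Eventually.of_forall fun x => ?_)
    simpa using hb x
  have iq : Integrable (fun x => |kde ψ a n (fun i => T^[(i : ℕ)] x) s - m| ^ q) μ := by
    refine Integrable.of_bound (C := (M / a + |m|) ^ q)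
      ((mk.sub_const m).abs.pow_const q).aestronglyMeasurable
      (Filter.Eventually.of_forall fun x => ?_)
    rw [Real.norm_eq_abs, abs_of_nonneg (by positivity)]
    exact Real.rpow_le_rpow (abs_nonneg _) (hb x) (by linarith)
  have hc := hconc n hn _ _ (kde_sepLip ψ L hlip a ha n hn s)
  rw [sum_const_rpow n hn (a ^ 2) L q hL (by positivity), ← hmdef] at hc
  have hLA : (L / (√n * a ^ 2)) ^ q ≤ A ^ q := by
    refine Real.rpow_le_rpow (by positivity) ?_ (by linarith)
    rw [hA, mul_one_div]
    gcongr; linarith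
  clear_value A
  calc _ ≤ ∫ x, (A + A * (|kde ψ a n (fun i => T^[(i : ℕ)] x) s - m| ^ q / A ^ q)) ∂μ :=
        integral_mono i1 ((integrable_const A).add ((iq.div_const _).const_mul _))
          fun x => rpow_young _ A q (abs_nonneg _) hA0 hq
    _ = A + A * ((∫ x, |kde ψ a n (fun i => T^[(i : ℕ)] x) s - m| ^ q ∂μ) / A ^ q) := by
      have := integral_add (integrable_const A) ((iq.div_const (A ^ q)).const_mul A)
      rw [integral_const_mul, integral_div] at this
      simpa using this
    _ ≤ A + A * Cq := by
      have : (∫ x, |kde ψ a n (fun i => T^[(i : ℕ)] x) s - m| ^ q ∂μ) / A ^ q ≤ Cq := by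
        rw [div_le_iff₀ (by positivity)]
        exact hc.trans (by gcongr)
      gcongr
    _ = _ := by ring

lemma kde_zero (X : Set ℝ) (R₀ : ℝ) (hXR : ∀ x ∈ X, |x| ≤ R₀)
    (T : ℝ → ℝ) (hTX : Set.MapsTo T X X)
    (ψ : ℝ → ℝ) (r : ℝ) (hr : 0 < r) (hsupp : ∀ s, r < |s| → ψ s = 0)
    (a : ℝ) (ha : 0 < a) (har : a * r ≤ 1) (n : ℕ) (x : ℝ) (hx : x ∈ X) (s : ℝ)
    (hs : R₀ + 1 < |s|) : kde ψ a n (fun i => T^[(i : ℕ)] x) s = 0 := by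
  unfold kde
  rw [Finset.sum_eq_zero, mul_zero]
  intro j _
  apply hsupp
  have h1 := hXR _ (hTX.iterate j hx)
  have h2 := abs_sub_abs_le_abs_sub s (T^[(j : ℕ)] x)
  rw [abs_div, abs_of_pos ha, lt_div_iff₀ ha]
  linarith

lemma mean_K (X : Set ℝ) (R₀ : ℝ) (hXR : ∀ x ∈ X, |x| ≤ R₀)
    (T : ℝ → ℝ) (hT : Measurable T) (hTX : Set.MapsTo T X X)
    (μ : Measure ℝ) [IsProbabilityMeasure μ] (hμX : ∀ᵐ x ∂μ, x ∈ X) (hinv : μ.map T = μ)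
    (q : ℝ) (hq : 2 ≤ q) (Cq : ℝ) (hCq : 0 < Cq)
    (hconc : ∀ (n : ℕ), 1 ≤ n → ∀ (K : (Fin n → ℝ) → ℝ) (L : Fin n → ℝ), SepLip K L →
      ∫ x, |K (fun i => T^[(i : ℕ)] x)
          - ∫ z, K (fun i => T^[(i : ℕ)] z) ∂μ| ^ q ∂μ
        ≤ Cq * (∑ j, L j ^ 2) ^ (q / 2))
    (ψ : ℝ → ℝ) (hψ : Integrable ψ) (hψm : Continuous ψ) (hψ0 : ∀ s, 0 ≤ ψ s)
    (h1 : ∫ s, ψ s = 1)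
    (M : ℝ) (hM : ∀ s, ψ s ≤ M) (L : ℝ) (hL : 0 ≤ L)
    (hlip : ∀ a b : ℝ, |ψ a - ψ b| ≤ L * |a - b|)
    (r : ℝ) (hr : 0 < r) (hsupp : ∀ s, r < |s| → ψ s = 0) (hR₀ : 0 ≤ R₀)
    (a : ℝ) (ha : 0 < a) (har : a * r ≤ 1) (n : ℕ) (hn : 1 ≤ n)
    (h : ℝ → ℝ) (hm : Measurable h) (hh : Integrable h) (hh0 : ∀ s, 0 ≤ h s) (hh1 : ∫ s, h s = 1)
    (hdens : μ = MeasureTheory.volume.withDensity fun s => ENNReal.ofReal (h s))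
    (C' β : ℝ) (hC' : 0 < C') (hβ : 0 < β)
    (hreg : ∀ σ : ℝ, (∫ s, |h s - h (s - σ)|) ≤ C' * |σ| ^ β) :
    ∫ x, (∫ s, |kde ψ a n (fun i => T^[(i : ℕ)] x) s - h s|) ∂μ
      ≤ (2 * (R₀ + 1)) * ((1 + Cq) * ((L + 1) * (1 / (√n * a ^ 2)))) + C' * (a * r) ^ β := by
  set F : ℝ → ℝ → ℝ := fun x s => kde ψ a n (fun i => T^[(i : ℕ)] x) s with hF
  set m : ℝ → ℝ := fun s => ∫ z, F z s ∂μ with hmd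
  have hM0 : 0 ≤ M := (hψ0 0).trans (hM 0)
  have mF : Measurable (fun p : ℝ × ℝ => F p.1 p.2) := kde_meas T hT ψ hψm a n
  have mm : StronglyMeasurable m := mF.stronglyMeasurable.integral_prod_left'
  have mm' := mm.measurable
  have F0 : ∀ x s, 0 ≤ F x s := fun x s => kde_nonneg ψ hψ0 a ha n _ s
  have FM : ∀ x s, F x s ≤ M / a := fun x s => kde_le ψ M hM a ha n hn _ s
  have m0 : ∀ s, 0 ≤ m s := fun s => integral_nonneg fun x => F0 x s
  have iFx : ∀ s, Integrable (fun x => F x s) μ := fun s =>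
    Integrable.of_bound (C := M / a)
      (mF.comp (measurable_id.prodMk measurable_const)).aestronglyMeasurable
      (Filter.Eventually.of_forall fun x => by
        rw [Real.norm_eq_abs, abs_of_nonneg (F0 x s)]; exact FM x s)
  have mM : ∀ s, m s ≤ M / a := by
    intro s
    have := integral_mono (iFx s) (integrable_const (M / a)) (fun x => FM x s)
    simpa using this
  have mz : ∀ s, R₀ + 1 < |s| → m s = 0 := by
    intro s hs
    refine integral_eq_zero_of_ae ?_
    filter_upwards [hμX] with x hx
    exact kde_zero X R₀ hXR T hTX ψ r hr hsupp a ha har n x hx s hs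
  have im : Integrable m := integrable_of_bdd_supp m mm.aestronglyMeasurable (M / a) (R₀ + 1)
    (fun s => by rw [abs_of_nonneg (m0 s)]; exact mM s) mz
  have iF : ∀ x, Integrable (F x) := fun x => kde_integrable ψ hψ a ha n _
  have hbias : ∫ s, |m s - h s| ≤ C' * (a * r) ^ β := by
    have := bias ψ hψ hψm hψ0 h1 M hM r hr hsupp a ha h hm hh hh0 hh1 C' β hC' hβ hreg
    simpa only [hmd, hF, kde_mean T hT μ hinv ψ hψm hψ0 M hM a ha n hn h hm hh0 hdens] using this
  set S : Set ℝ := Set.Icc (-(R₀ + 1)) (R₀ + 1) with hS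
  have hGb : ∀ x s, |F x s - m s| ≤ M / a := by
    intro x s
    rw [abs_le]; constructor <;> linarith [F0 x s, FM x s, m0 s, mM s]
  have iG : Integrable (fun p : ℝ × ℝ => |F p.1 p.2 - m p.2|) (μ.prod (volume.restrict S)) := by
    refine Integrable.of_bound (C := M / a) ?_ (Filter.Eventually.of_forall fun p => ?_)
    · exact (mF.sub (mm'.comp measurable_snd)).abs.aestronglyMeasurable
    · rw [Real.norm_eq_abs, abs_abs]; exact hGb _ _
  have hfl : ∫ x, (∫ s in S, |F x s - m s|) ∂μ
      ≤ (2 * (R₀ + 1)) * ((1 + Cq) * ((L + 1) * (1 / (√n * a ^ 2)))) := by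
    rw [integral_integral_swap iG]
    calc _ ≤ ∫ s in S, ((1 + Cq) * ((L + 1) * (1 / (√n * a ^ 2)))) := by
          refine integral_mono iG.integral_prod_right (integrable_const _) fun s => ?_
          exact fluct_point T hT μ q hq Cq hCq hconc ψ hψm hψ0 M hM L hL hlip a ha n hn s
      _ = _ := by
        rw [setIntegral_const, smul_eq_mul, hS, Real.volume_real_Icc_of_le (by linarith)]
        ring
  calc _ ≤ ∫ x, ((∫ s in S, |F x s - m s|) + ∫ s, |m s - h s|) ∂μ := by
        refine integral_mono_of_nonneg
          (Filter.Eventually.of_forall fun x => integral_nonneg fun s => abs_nonneg _)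
          (iG.integral_prod_left.add (integrable_const _)) ?_
        filter_upwards [hμX] with x hx
        have hz : ∀ s, s ∉ S → |F x s - m s| = 0 := by
          intro s hs
          have hs' : R₀ + 1 < |s| := by
            by_contra h2
            exact hs (abs_le.1 (not_lt.1 h2))
          rw [mz s hs', show F x s = 0 from
            kde_zero X R₀ hXR T hTX ψ r hr hsupp a ha har n x hx s hs']
          simp
        have j1 : Integrable (fun s => |F x s - m s|) := ((iF x).sub im).abs
        have j2 : Integrable (fun s => |m s - h s|) := (im.sub hh).abs
        rw [setIntegral_eq_integral_of_forall_compl_eq_zero hz, ← integral_add j1 j2]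
        refine integral_mono ((iF x).sub hh).abs (j1.add j2) fun s => ?_
        exact abs_sub_le _ _ _
    _ = (∫ x, (∫ s in S, |F x s - m s|) ∂μ) + ∫ s, |m s - h s| := by
      rw [integral_add iG.integral_prod_left (integrable_const _)]
      simp
    _ ≤ _ := add_le_add hfl hbias

/-- `L¹` deviation bound for the kernel density estimator
`ĥ_n(x;s) = (1/(n αₙ)) ∑_{j<n} ψ((s - T^j x)/αₙ)`, for a system satisfying the
polynomial concentration inequality with moment `q ≥ 2`. -/
theorem kernel_density_estimator_polynomial
    (X : Set ℝ) (hXb : Bornology.IsBounded X) (hXm : MeasurableSet X)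
    (T : ℝ → ℝ) (hT : Measurable T) (hTX : Set.MapsTo T X X)
    (μ : Measure ℝ) [IsProbabilityMeasure μ] (hμX : μ X = 1) (hinv : μ.map T = μ)
    (h : ℝ → ℝ) (hh_meas : Measurable h) (hh_nonneg : ∀ s, 0 ≤ h s)
    (hdens : μ = MeasureTheory.volume.withDensity fun s => ENNReal.ofReal (h s))
    (C' β : ℝ) (hC' : 0 < C') (hβ : 0 < β)
    (hreg : ∀ σ : ℝ, (∫ s, |h s - h (s - σ)|) ≤ C' * |σ| ^ β)
    (q : ℝ) (hq : 2 ≤ q) (Cq : ℝ) (hCq : 0 < Cq)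
    (hconc : ∀ (n : ℕ), 1 ≤ n → ∀ (K : (Fin n → ℝ) → ℝ) (L : Fin n → ℝ), SepLip K L →
      ∫ x, |K (fun i => T^[(i : ℕ)] x)
          - ∫ z, K (fun i => T^[(i : ℕ)] z) ∂μ| ^ q ∂μ
        ≤ Cq * (∑ j, L j ^ 2) ^ (q / 2))
    (ψ : ℝ → ℝ) (hψ_nonneg : ∀ s, 0 ≤ ψ s) (hψ_supp : HasCompactSupport ψ)
    (Lψ : ℝ) (hLψ : 0 ≤ Lψ) (hψ_lip : ∀ a b : ℝ, |ψ a - ψ b| ≤ Lψ * |a - b|)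
    (hψ_int : (∫ s, ψ s) = 1)
    (α : ℕ → ℝ) (hα : ∀ n, 0 < α n) :
    ∃ Cψ : ℝ, 0 < Cψ ∧ ∀ (n : ℕ), 1 ≤ n → ∀ t : ℝ,
      Cψ * ((α n) ^ β + 1 / (Real.sqrt n * (α n) ^ 2)) < t →
      (μ {x | t < ∫ s, |(1 / ((n : ℝ) * α n))
            * ∑ j ∈ Finset.range n, ψ ((s - T^[j] x) / α n) - h s|}).toReal
        ≤ (Cq / t ^ q) * (Lψ / (Real.sqrt n * (α n) ^ 2)) ^ q := by
  have hψm : Continuous ψ := by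
    refine (LipschitzWith.of_dist_le_mul (K := ⟨Lψ, hLψ⟩) fun a b => ?_).continuous
    exact hψ_lip a b
  have hψ : Integrable ψ := hψm.integrable_of_hasCompactSupport hψ_supp
  obtain ⟨r, hr, hsupp⟩ : ∃ r : ℝ, 0 < r ∧ ∀ s, r < |s| → ψ s = 0 := by
    obtain ⟨r, hr⟩ := hψ_supp.isCompact.isBounded.exists_norm_le
    refine ⟨max r 1, by positivity, fun s hs => ?_⟩
    by_contra hc
    have := hr s (subset_tsupport ψ hc)
    rw [Real.norm_eq_abs] at this
    exact absurd (this.trans (le_max_left r 1)) (not_le.2 hs)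
  obtain ⟨M, hM⟩ : ∃ M, ∀ s, ψ s ≤ M := by
    obtain ⟨M, hM⟩ := hψm.bounded_above_of_compact_support hψ_supp
    exact ⟨M, fun s => (le_abs_self _).trans (hM s)⟩
  obtain ⟨R₀, hR₀, hXR⟩ : ∃ R₀ : ℝ, 0 ≤ R₀ ∧ ∀ x ∈ X, |x| ≤ R₀ := by
    obtain ⟨R, hR⟩ := hXb.exists_norm_le
    exact ⟨max R 0, by positivity, fun x hx => (hR x hx).trans (le_max_left _ _)⟩
  have hμX' : ∀ᵐ x ∂μ, x ∈ X := by
    rw [ae_iff]; exact (prob_compl_eq_zero_iff hXm).2 hμX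
  have hl : ∫⁻ s, ENNReal.ofReal (h s) = 1 := by
    have : μ Set.univ = 1 := measure_univ
    rwa [hdens, withDensity_apply _ MeasurableSet.univ, setLIntegral_univ] at this
  have hh : Integrable h := by
    refine ⟨hh_meas.aestronglyMeasurable, ?_⟩
    rw [hasFiniteIntegral_iff_ofReal (Filter.Eventually.of_forall hh_nonneg), hl]
    simp
  have hh1 : ∫ s, h s = 1 := by
    rw [integral_eq_lintegral_of_nonneg_ae (Filter.Eventually.of_forall hh_nonneg)
      hh_meas.aestronglyMeasurable, hl]
    simp
  set D : ℝ := (2 * (R₀ + 1)) * ((1 + Cq) * (Lψ + 1)) with hD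
  have hD0 : 0 < D := by positivity
  set E : ℝ := C' * r ^ β with hE
  have hE0 : 0 < E := by positivity
  set a₀ : ℝ := 1 / (8 * r) with ha₀
  have ha₀' : 0 < a₀ := by positivity
  refine ⟨2 * D + 2 * E + 2 / a₀ ^ β, by positivity, ?_⟩
  intro n hn t ht
  have ha := hα n
  generalize α n = a at ht ha ⊢
  have hn' : (0 : ℝ) < n := by positivity
  set K : ℝ → ℝ := fun x => ∫ s, |kde ψ a n (fun i => T^[(i : ℕ)] x) s - h s| with hK
  have hset : {x | t < ∫ s, |(1 / ((n : ℝ) * a))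
      * ∑ j ∈ Finset.range n, ψ ((s - T^[j] x) / a) - h s|} = {x | t < K x} := by
    simp only [hK, kde, Finset.sum_range]
  rw [hset]
  have hK0 : ∀ x, 0 ≤ K x := fun x => integral_nonneg fun s => abs_nonneg _
  have hK2 : ∀ x, K x ≤ 2 := fun x =>
    K_le_two ψ hψ hψ_nonneg hψ_int a ha n hn h hh hh_nonneg hh1 _
  have hp1 : 0 < a ^ β := by positivity
  have hp2 : 0 < 1 / (√n * a ^ 2) := by positivity
  have hp3 : 0 < 2 / a₀ ^ β := by positivity
  have ht0 : 0 < t := lt_trans (by positivity) ht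
  by_cases hcase : a₀ ≤ a
  · have : {x | t < K x} = ∅ := by
      ext x
      simp only [Set.mem_ofPred_eq, Set.mem_empty_iff_false, iff_false, not_lt]
      refine (hK2 x).trans (le_trans ?_ ht.le)
      have e1 : a₀ ^ β ≤ a ^ β := Real.rpow_le_rpow ha₀'.le hcase hβ.le
      have e2 : 2 = 2 / a₀ ^ β * a₀ ^ β := by field_simp
      have e3 : 2 / a₀ ^ β * a₀ ^ β ≤ 2 / a₀ ^ β * a ^ β := by gcongr
      have e4 : 0 ≤ (2 * D + 2 * E) * a ^ β := by positivity
      have e5 : 0 ≤ (2 * D + 2 * E + 2 / a₀ ^ β) * (1 / (√n * a ^ 2)) := by positivity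
      nlinarith
    rw [this]
    simp only [measure_empty, ENNReal.toReal_zero]
    positivity
  have ha8 : 8 * r * a ≤ 1 := by
    have := not_le.1 hcase
    rw [ha₀, lt_div_iff₀ (by positivity)] at this
    linarith
  have har : a * r ≤ 1 := by nlinarith [mul_pos ha hr]
  have hmean := mean_K X R₀ hXR T hT hTX μ hμX' hinv q hq Cq hCq hconc ψ hψ hψm hψ_nonneg hψ_int
    M hM Lψ hLψ hψ_lip r hr hsupp hR₀ a ha har n hn h hh_meas hh hh_nonneg hh1 hdens C' β hC' hβ hreg
  have hmt : ∫ x, K x ∂μ ≤ t / 2 := by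
    refine hmean.trans ?_
    rw [Real.mul_rpow ha.le hr.le]
    have e1 : (2 * (R₀ + 1)) * ((1 + Cq) * ((Lψ + 1) * (1 / (√n * a ^ 2)))) =
      D * (1 / (√n * a ^ 2)) := by rw [hD]; ring
    have e2 : C' * (a ^ β * r ^ β) = E * a ^ β := by rw [hE]; ring
    rw [e1, e2]
    have e3 : 0 ≤ 2 / a₀ ^ β * (a ^ β + 1 / (√n * a ^ 2)) := by positivity
    have e4 : 0 ≤ D * a ^ β := by positivity
    have e5 : 0 ≤ E * (1 / (√n * a ^ 2)) := by positivity
    nlinarith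
  have hc := hconc n hn _ _ (K_sepLip ψ hψ Lψ hLψ hψ_lip r hr hsupp a ha n hn h hh)
  rw [sum_const_rpow n hn a (4 * r * Lψ) q (by positivity) ha] at hc
  change ∫ x, |K x - ∫ z, K z ∂μ| ^ q ∂μ ≤ _ at hc
  set m := ∫ z, K z ∂μ with hm
  have mK : Measurable K := by
    have : Measurable (fun p : ℝ × ℝ => |kde ψ a n (fun i => T^[(i : ℕ)] p.1) p.2 - h p.2|) :=
      ((kde_meas T hT ψ hψm a n).sub (hh_meas.comp measurable_snd)).abs
    exact this.stronglyMeasurable.integral_prod_right'.measurable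
  have iq : Integrable (fun x => |K x - m| ^ q) μ := by
    refine Integrable.of_bound (C := (2 + |m|) ^ q)
      ((mK.sub_const m).abs.pow_const q).aestronglyMeasurable
      (Filter.Eventually.of_forall fun x => ?_)
    rw [Real.norm_eq_abs, abs_of_nonneg (by positivity)]
    refine Real.rpow_le_rpow (abs_nonneg _) ((abs_sub _ _).trans ?_) (by linarith)
    rw [abs_of_nonneg (hK0 x)]
    gcongr
    exact hK2 x
  have hmark := mul_meas_ge_le_integral_of_nonneg
    (Filter.Eventually.of_forall fun x => (by positivity : 0 ≤ |K x - m| ^ q)) iq ((t / 2) ^ q)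
  have hsub : μ.real {x | t < K x} ≤ μ.real {x | (t / 2) ^ q ≤ |K x - m| ^ q} := by
    refine measureReal_mono fun x hx => ?_
    simp only [Set.mem_ofPred_eq] at hx ⊢
    refine Real.rpow_le_rpow (by positivity) ?_ (by linarith)
    exact le_trans (by linarith) (le_abs_self _)
  change μ.real {x | t < K x} ≤ _
  have htq : 0 < (t / 2) ^ q := by positivity
  have hfin : (t / 2) ^ q * μ.real {x | t < K x} ≤ Cq * (4 * r * Lψ / (√n * a)) ^ q :=
    (mul_le_mul_of_nonneg_left hsub htq.le).trans (hmark.trans hc)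
  have hlast : (4 * r * Lψ / (√n * a)) ^ q ≤ (Lψ / (√n * a ^ 2) / 2) ^ q := by
    refine Real.rpow_le_rpow (by positivity) ?_ (by linarith)
    have : 4 * r * Lψ / (√n * a) = (8 * r * a) * (Lψ / (√n * a ^ 2) / 2) := by field_simp; ring
    rw [this]
    exact mul_le_of_le_one_left (by positivity) ha8
  have hstep : (t / 2) ^ q * μ.real {x | t < K x} ≤ Cq * (Lψ / (√n * a ^ 2) / 2) ^ q :=
    hfin.trans (by gcongr)
  rw [Real.div_rpow ht0.le (by norm_num), Real.div_rpow (by positivity) (by norm_num)] at hstep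
  have h2q : (0 : ℝ) < 2 ^ q := by positivity
  have htq' : (0 : ℝ) < t ^ q := by positivity
  rw [div_mul_eq_mul_div, ← mul_div_assoc, div_le_div_iff_of_pos_right h2q] at hstep
  rw [div_mul_eq_mul_div, le_div_iff₀ htq']
  linarith
end
end

section
/- Let X be a bounded Borel subset of ℝ, T : X → X Borel measurable, and μ a T-invariant probability measure absolutely continuous with density h satisfying ∫ |h(s) − h(s − σ)| ds ≤ C' |σ|^β for some C', β > 0 and all σ ∈ ℝ. Suppose (X,T,μ) satisfies the exponential concentration inequality. Let ψ : ℝ → ℝ be a bounded, non-negative Lipschitz kernel with bounded support and ∫ ψ(s) ds = 1, and let (α_n) be positive reals. Then there exist constants C_ψ > 0 and D > 0 such that for every ε > 0, every n ≥ 1, and every t > C_ψ (α_n^β + 1/(√n α_n²)), the observed density estimator h̃_n(y_0,…,y_{n−1}; s) = (1/(n α_n)) Σ_{j=0}^{n−1} ψ((s − y_j)/α_n) satisfies μ_n ⊗ P^n(∫ |h̃_n(y_0,…,y_{n−1}; s) − h(s)| ds > t + Lip(ψ) ε / α_n²) ≤ exp(−n α_n⁴ t² / (4 D Lip(ψ)²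 (1 + ε²))). -/
open MeasureTheory Real

noncomputable section

/-- The kernel density estimator. -/
def kdeG {n : ℕ} (ψ : ℝ → ℝ) (a : ℝ) (y : Fin n → ℝ) (s : ℝ) : ℝ :=
  (1 / ((n : ℝ) * a)) * ∑ j : Fin n, ψ ((s - y j) / a)

theorem kde_integrable_comp (ψ : ℝ → ℝ) (hi : Integrable ψ) (a : ℝ) (ha : 0 < a) (y : ℝ) :
    Integrable (fun s => ψ ((s - y) / a)) :=
  (hi.comp_div ha.ne').comp_sub_right y

theorem kde_integral_comp (f : ℝ → ℝ) (a : ℝ) (ha : 0 < a) (y : ℝ) :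
    ∫ s, f ((s - y) / a) = a * ∫ s, f s := by
  rw [integral_sub_right_eq_self (fun s => f (s / a)) y, Measure.integral_comp_div]
  simp [abs_of_pos ha]

theorem kde_shift (ψ : ℝ → ℝ) (hi : Integrable ψ) (R Lψ : ℝ) (hR : 0 < R) (hLψ : 0 ≤ Lψ)
    (hRψ : ∀ v, R < |v| → ψ v = 0)
    (hψ_lip : ∀ a b : ℝ, |ψ a - ψ b| ≤ Lψ * |a - b|) (c : ℝ) :
    ∫ s, |ψ s - ψ (s + c)| ≤ 4 * R * (Lψ * |c|) := by
  have hind : Integrable ((Set.Icc (-R) R).indicator (fun _ : ℝ => Lψ * |c|)) := by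
    rw [integrable_indicator_iff measurableSet_Icc]
    exact integrableOn_const (by simp)
  have hval : ∫ s, (Set.Icc (-R) R).indicator (fun _ : ℝ => Lψ * |c|) s = 2 * R * (Lψ * |c|) := by
    rw [integral_indicator measurableSet_Icc]
    simp [Measure.real, ENNReal.toReal_ofReal (by linarith : 0 ≤ R + R)]
    left; ring
  have hsh := integral_add_right_eq_self (μ := volume)
    ((Set.Icc (-R) R).indicator (fun _ : ℝ => Lψ * |c|)) c
  calc ∫ s, |ψ s - ψ (s + c)|
      ≤ ∫ s, ((Set.Icc (-R) R).indicator (fun _ : ℝ => Lψ * |c|) s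
        + (Set.Icc (-R) R).indicator (fun _ : ℝ => Lψ * |c|) (s + c)) := by
        apply integral_mono
        · exact (hi.sub (hi.comp_add_right c)).abs
        · exact hind.add (hind.comp_add_right c)
        · intro s
          have hnn : ∀ u, 0 ≤ (Set.Icc (-R) R).indicator (fun _ : ℝ => Lψ * |c|) u :=
            fun u => Set.indicator_nonneg (fun _ _ => by positivity) u
          have hl : |ψ s - ψ (s + c)| ≤ Lψ * |c| := by
            have := hψ_lip s (s + c)
            simpa using this
          by_cases h1 : |s| ≤ R
          · have : s ∈ Set.Icc (-R) R := abs_le.mp h1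
            have h2 := hnn (s + c)
            simp only [Set.indicator_of_mem this]
            linarith
          · by_cases h2 : |s + c| ≤ R
            · have : s + c ∈ Set.Icc (-R) R := abs_le.mp h2
              have h3 := hnn s
              simp only [Set.indicator_of_mem this]
              linarith
            · simp only [hRψ s (not_le.mp h1), hRψ _ (not_le.mp h2)]
              have h3 := hnn s
              have h4 := hnn (s + c)
              simp only [sub_zero, abs_zero]
              linarith
    _ = 4 * R * (Lψ * |c|) := by
        rw [integral_add hind (hind.comp_add_right c), hsh, hval]; ring

theorem kde_shift2 (ψ : ℝ → ℝ) (hi : Integrable ψ) (R Lψ : ℝ) (hR : 0 < R) (hLψ : 0 ≤ Lψ)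
    (hRψ : ∀ v, R < |v| → ψ v = 0)
    (hψ_lip : ∀ a b : ℝ, |ψ a - ψ b| ≤ Lψ * |a - b|) (a : ℝ) (ha : 0 < a) (y y' : ℝ) :
    ∫ s, |ψ ((s - y) / a) - ψ ((s - y') / a)| ≤ 4 * R * Lψ * |y - y'| := by
  have h1 := kde_integral_comp (fun v => |ψ v - ψ (v + (y - y') / a)|) a ha y
  have h2 : ∀ s, (s - y) / a + (y - y') / a = (s - y') / a := fun s => by ring
  simp only [h2] at h1
  rw [h1]
  have h3 := kde_shift ψ hi R Lψ hR hLψ hRψ hψ_lip ((y - y') / a)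
  calc _ ≤ a * (4 * R * (Lψ * |(y - y') / a|)) := by gcongr
    _ = _ := by rw [abs_div, abs_of_pos ha]; field_simp

theorem kdeG_integrable {n : ℕ} (ψ : ℝ → ℝ) (hi : Integrable ψ) (a : ℝ) (ha : 0 < a)
    (y : Fin n → ℝ) : Integrable (kdeG ψ a y) :=
  (integrable_finsetSum _ fun j _ => kde_integrable_comp ψ hi a ha (y j)).const_mul _

theorem kdeG_nonneg {n : ℕ} (ψ : ℝ → ℝ) (h0 : ∀ s, 0 ≤ ψ s) (a : ℝ) (ha : 0 < a)
    (y : Fin n → ℝ) (s : ℝ) : 0 ≤ kdeG ψ a y s :=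
  mul_nonneg (by positivity) (Finset.sum_nonneg fun j _ => h0 _)

theorem kdeG_integral {n : ℕ} (hn : 1 ≤ n) (ψ : ℝ → ℝ) (hi : Integrable ψ)
    (h1 : ∫ s, ψ s = 1) (a : ℝ) (ha : 0 < a)
    (y : Fin n → ℝ) : ∫ s, kdeG ψ a y s = 1 := by
  have : (n : ℝ) ≠ 0 := by positivity
  unfold kdeG
  rw [integral_const_mul, integral_finsetSum _ fun j _ => kde_integrable_comp ψ hi a ha (y j)]
  simp only [kde_integral_comp ψ a ha, h1]
  simp
  field_simp

/-- The `L¹` distance. -/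
def kdeK {n : ℕ} (ψ h : ℝ → ℝ) (a : ℝ) (y : Fin n → ℝ) : ℝ := ∫ s, |kdeG ψ a y s - h s|

theorem kdeK_le_two {n : ℕ} (hn : 1 ≤ n) (ψ h : ℝ → ℝ) (h0 : ∀ s, 0 ≤ ψ s) (hi : Integrable ψ)
    (h1 : ∫ s, ψ s = 1) (hh : Integrable h) (hh0 : ∀ s, 0 ≤ h s) (hh1 : ∫ s, h s = 1)
    (a : ℝ) (ha : 0 < a) (y : Fin n → ℝ) : kdeK ψ h a y ≤ 2 := by
  have hG := kdeG_integrable ψ hi a ha y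
  calc _ ≤ ∫ s, (kdeG ψ a y s + h s) := by
        apply integral_mono (hG.sub hh).abs (hG.add hh)
        intro s
        have := kdeG_nonneg ψ h0 a ha y s
        have := hh0 s
        exact abs_le.mpr ⟨by simp only [Pi.add_apply, Pi.sub_apply]; linarith, by simp only [Pi.add_apply, Pi.sub_apply]; linarith⟩
    _ = 2 := by rw [integral_add hG hh, kdeG_integral hn ψ hi h1 a ha, hh1]; norm_num

theorem kdeK_sub {n : ℕ} (ψ h : ℝ → ℝ) (hi : Integrable ψ) (hh : Integrable h)
    (R Lψ : ℝ) (hR : 0 < R) (hLψ : 0 ≤ Lψ) (hRψ : ∀ v, R < |v| → ψ v = 0)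
    (hψ_lip : ∀ a b : ℝ, |ψ a - ψ b| ≤ Lψ * |a - b|) (a : ℝ) (ha : 0 < a) (y y' : Fin n → ℝ) :
    |kdeK ψ h a y - kdeK ψ h a y'| ≤ 4 * R * Lψ / (n * a) * ∑ j, |y j - y' j| := by
  have hG := kdeG_integrable ψ hi a ha y
  have hG' := kdeG_integrable ψ hi a ha y'
  have hd : ∀ j, Integrable (fun s => |ψ ((s - y j) / a) - ψ ((s - y' j) / a)|) := fun j =>
    ((kde_integrable_comp ψ hi a ha (y j)).sub (kde_integrable_comp ψ hi a ha (y' j))).abs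
  unfold kdeK
  have e1 : Integrable (fun s => |kdeG ψ a y s - h s|) := (hG.sub hh).abs
  have e2 : Integrable (fun s => |kdeG ψ a y' s - h s|) := (hG'.sub hh).abs
  rw [← integral_sub e1 e2]
  calc _ ≤ ∫ s, |(|kdeG ψ a y s - h s| - |kdeG ψ a y' s - h s|)| := abs_integral_le_integral_abs
    _ ≤ ∫ s, (1 / ((n : ℝ) * a)) * ∑ j : Fin n, |ψ ((s - y j) / a) - ψ ((s - y' j) / a)| := by
        apply integral_mono
        · exact (e1.sub e2).abs
        · exact (integrable_finsetSum _ fun j _ => hd j).const_mul _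
        intro s
        refine (abs_abs_sub_abs_le _ _).trans ?_
        have : kdeG ψ a y s - h s - (kdeG ψ a y' s - h s)
          = (1 / ((n : ℝ) * a)) * ∑ j : Fin n, (ψ ((s - y j) / a) - ψ ((s - y' j) / a)) := by
          unfold kdeG; rw [Finset.sum_sub_distrib]; ring
        rw [this, abs_mul, abs_of_nonneg (by positivity : 0 ≤ 1 / ((n : ℝ) * a))]
        exact mul_le_mul_of_nonneg_left (Finset.abs_sum_le_sum_abs _ _) (by positivity)
    _ ≤ (1 / ((n : ℝ) * a)) * ∑ j : Fin n, (4 * R * Lψ * |y j - y' j|) := by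
        rw [integral_const_mul, integral_finsetSum _ fun j _ => hd j]
        gcongr with j
        exact kde_shift2 ψ hi R Lψ hR hLψ hRψ hψ_lip a ha _ _
    _ = _ := by rw [← Finset.mul_sum]; ring

theorem kdeK_sepLip {n : ℕ} (ψ h : ℝ → ℝ) (hi : Integrable ψ) (hh : Integrable h)
    (R Lψ : ℝ) (hR : 0 < R) (hLψ : 0 ≤ Lψ) (hRψ : ∀ v, R < |v| → ψ v = 0)
    (hψ_lip : ∀ a b : ℝ, |ψ a - ψ b| ≤ Lψ * |a - b|) (a : ℝ) (ha : 0 < a) :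
    SepLip (n := n) (kdeK ψ h a) (fun _ => 4 * R * Lψ / (n * a)) := by
  intro x j y
  refine (kdeK_sub ψ h hi hh R Lψ hR hLψ hRψ hψ_lip a ha _ _).trans (le_of_eq ?_)
  congr 1
  rw [Finset.sum_eq_single j]
  · simp [Real.dist_eq]
  · intro b _ hb; simp [hb]
  · simp

theorem kdeG_sepLip {n : ℕ} (ψ : ℝ → ℝ) (Lψ : ℝ)
    (hψ_lip : ∀ a b : ℝ, |ψ a - ψ b| ≤ Lψ * |a - b|) (a : ℝ) (ha : 0 < a) (s : ℝ) :
    SepLip (n := n) (fun y => kdeG ψ a y s) (fun _ => Lψ / (n * a ^ 2)) := by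
  intro x j y
  simp only [kdeG]
  rw [← mul_sub, ← Finset.sum_sub_distrib, Finset.sum_eq_single j]
  · rw [abs_mul, abs_of_nonneg (by positivity : 0 ≤ 1 / ((n : ℝ) * a))]
    have h1 := hψ_lip ((s - x j) / a) ((s - y) / a)
    have h2 : (s - x j) / a - (s - y) / a = -(x j - y) / a := by ring
    rw [h2, abs_div, abs_neg, abs_of_pos ha] at h1
    simp only [Function.update_self, Real.dist_eq]
    calc _ ≤ 1 / (n * a) * (Lψ * (|x j - y| / a)) := by gcongr
      _ = _ := by field_simp
  · intro b _ hb; simp [hb]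
  · simp

/-- Separate Lipschitz scaling. -/
theorem SepLip_smul {n : ℕ} (K : (Fin n → ℝ) → ℝ) (L : Fin n → ℝ) (hK : SepLip K L) (l : ℝ) :
    SepLip (fun x => l * K x) (fun j => |l| * L j) := by
  intro x j y
  simp only
  rw [← mul_sub, abs_mul, mul_assoc]
  gcongr
  exact hK x j y

theorem mgf_bound (T : ℝ → ℝ) (μ : Measure ℝ) [IsProbabilityMeasure μ] (C : ℝ)
    (hconc : ∀ (n : ℕ), 1 ≤ n → ∀ (K : (Fin n → ℝ) → ℝ) (L : Fin n → ℝ), SepLip K L →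
      ∫ x, Real.exp (K (fun i => T^[(i : ℕ)] x)
          - ∫ z, K (fun i => T^[(i : ℕ)] z) ∂μ) ∂μ
        ≤ Real.exp (C * ∑ j, L j ^ 2))
    {n : ℕ} (hn : 1 ≤ n) (K : (Fin n → ℝ) → ℝ) (L : Fin n → ℝ) (hK : SepLip K L) (l : ℝ) :
    ∫ x, Real.exp (l * (K (fun i => T^[(i : ℕ)] x)
          - ∫ z, K (fun i => T^[(i : ℕ)] z) ∂μ)) ∂μ ≤ Real.exp (l ^ 2 * (C * ∑ j, L j ^ 2)) := by
  have := hconc n hn _ _ (SepLip_smul K L hK l)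
  simp only [integral_const_mul, ← mul_sub, mul_pow, sq_abs, ← Finset.mul_sum] at this
  refine this.trans (le_of_eq ?_)
  congr 1; ring

theorem exp_integrable (μ : Measure ℝ) [IsProbabilityMeasure μ] (Z : ℝ → ℝ) (hZ : Measurable Z)
    (B : ℝ) (hB : ∀ x, |Z x| ≤ B) (l : ℝ) :
    Integrable (fun x => Real.exp (l * Z x)) μ := by
  refine Integrable.of_bound (C := Real.exp (|l| * B)) (by fun_prop) (ae_of_all _ fun x => ?_)
  rw [Real.norm_eq_abs, Real.abs_exp]
  apply Real.exp_le_exp.mpr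
  calc l * Z x ≤ |l * Z x| := le_abs_self _
    _ = |l| * |Z x| := abs_mul _ _
    _ ≤ _ := by gcongr; exact hB x

theorem abs_mean_bound (μ : Measure ℝ) [IsProbabilityMeasure μ] (Z : ℝ → ℝ) (hZ : Measurable Z)
    (B : ℝ) (hB : ∀ x, |Z x| ≤ B) (V C : ℝ) (hV : 0 < V)
    (hm : ∀ l, ∫ x, Real.exp (l * Z x) ∂μ ≤ Real.exp (l ^ 2 * (C * V))) :
    ∫ x, |Z x| ∂μ ≤ 2 * Real.exp C * √V := by
  set l := 1 / √V with hl
  have hs : 0 < √V := Real.sqrt_pos.mpr hV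
  have hl0 : 0 < l := by positivity
  have hl2 : l ^ 2 * (C * V) = C := by
    rw [hl, div_pow, Real.sq_sqrt hV.le]; field_simp
  have i1 := exp_integrable μ Z hZ B hB l
  have i2 := exp_integrable μ Z hZ B hB (-l)
  have hp : ∀ x, |Z x| ≤ √V * (Real.exp (l * Z x) + Real.exp (-l * Z x)) := by
    intro x
    have h1 : |l * Z x| ≤ Real.exp (l * Z x) + Real.exp (-l * Z x) := by
      rcases abs_cases (l * Z x) with ⟨h, _⟩ | ⟨h, _⟩
      · rw [h]; have := Real.add_one_le_exp (l * Z x); have := Real.exp_pos (-l * Z x); linarith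
      · rw [h]; have := Real.add_one_le_exp (-l * Z x); have := Real.exp_pos (l * Z x); linarith
    rw [abs_mul, abs_of_pos hl0] at h1
    calc |Z x| = √V * (l * |Z x|) := by rw [hl]; field_simp
      _ ≤ _ := by gcongr
  calc _ ≤ ∫ x, √V * (Real.exp (l * Z x) + Real.exp (-l * Z x)) ∂μ := by
        apply integral_mono _ ((i1.add i2).const_mul _) hp
        exact (Integrable.of_bound (C := B) hZ.aestronglyMeasurable (ae_of_all _ hB)).abs
    _ ≤ √V * (Real.exp C + Real.exp C) := by
        rw [integral_const_mul, integral_add i1 i2]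
        have a1 := hm l
        have a2 := hm (-l)
        rw [neg_sq] at a2
        rw [hl2] at a1 a2
        gcongr
    _ = _ := by ring

theorem tail_bound (μ : Measure ℝ) [IsProbabilityMeasure μ] (Z : ℝ → ℝ) (hZ : Measurable Z)
    (B : ℝ) (hB : ∀ x, |Z x| ≤ B) (V C : ℝ) (hV : 0 < V) (hC : 0 < C)
    (hm : ∀ l, ∫ x, Real.exp (l * Z x) ∂μ ≤ Real.exp (l ^ 2 * (C * V))) (r : ℝ) (hr : 0 ≤ r) :
    μ.real {x | r ≤ Z x} ≤ Real.exp (-(r ^ 2 / (4 * C * V))) := by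
  set l := r / (2 * C * V) with hl
  have hl0 : 0 ≤ l := by positivity
  have := ProbabilityTheory.measure_ge_le_exp_mul_mgf (μ := μ) (X := Z) r hl0
    (exp_integrable μ Z hZ B hB l)
  refine this.trans ?_
  calc _ ≤ Real.exp (-l * r) * Real.exp (l ^ 2 * (C * V)) := by
        gcongr; exact hm l
    _ = _ := by
        rw [← Real.exp_add]; congr 1; rw [hl]; field_simp; ring

/-- The trajectory. -/
def traj (T : ℝ → ℝ) (n : ℕ) (x : ℝ) : Fin n → ℝ := fun i => T^[(i : ℕ)] x

theorem kdeG_meas (T : ℝ → ℝ) (hT : Measurable T) (n : ℕ) (ψ : ℝ → ℝ) (hc : Continuous ψ) (a : ℝ) :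
    Measurable (fun p : ℝ × ℝ => kdeG ψ a (traj T n p.1) p.2) := by
  have hj : ∀ j : ℕ, Measurable (T^[j]) := fun j => hT.iterate j
  have hψ := hc.measurable
  unfold kdeG traj
  fun_prop

theorem kdeG_prod_integrable (T : ℝ → ℝ) (hT : Measurable T) {n : ℕ} (hn : 1 ≤ n)
    (μ : Measure ℝ) [IsProbabilityMeasure μ]
    (ψ : ℝ → ℝ) (hc : Continuous ψ) (h0 : ∀ s, 0 ≤ ψ s) (hi : Integrable ψ)
    (h1 : ∫ s, ψ s = 1) (a : ℝ) (ha : 0 < a) :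
    Integrable (fun p : ℝ × ℝ => kdeG ψ a (traj T n p.1) p.2) (μ.prod volume) := by
  rw [integrable_prod_iff (kdeG_meas T hT n ψ hc a).aestronglyMeasurable]
  refine ⟨ae_of_all _ fun x => kdeG_integrable ψ hi a ha (traj T n x), ?_⟩
  simp only [Real.norm_eq_abs, abs_of_nonneg (kdeG_nonneg ψ h0 a ha _ _),
    kdeG_integral hn ψ hi h1 a ha]
  exact integrable_const _

theorem mean_formula (T : ℝ → ℝ) (hT : Measurable T) {n : ℕ} (hn : 1 ≤ n)
    (μ : Measure ℝ) [IsProbabilityMeasure μ] (hinv : μ.map T = μ)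
    (h : ℝ → ℝ) (hh_meas : Measurable h) (hh_nonneg : ∀ s, 0 ≤ h s)
    (hdens : μ = MeasureTheory.volume.withDensity fun s => ENNReal.ofReal (h s))
    (ψ : ℝ → ℝ) (hc : Continuous ψ) (B : ℝ) (hB : ∀ s, |ψ s| ≤ B) (a : ℝ) (ha : 0 < a) (s : ℝ) :
    ∫ z, kdeG ψ a (traj T n z) s ∂μ = ∫ v, ψ v * h (s - a * v) := by
  have hn' : (n : ℝ) ≠ 0 := by positivity
  have hψm := hc.measurable
  have hj : ∀ j : ℕ, Measurable (T^[j]) := fun j => hT.iterate j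
  have hmp : MeasurePreserving T μ μ := ⟨hT, hinv⟩
  have key : ∀ j : ℕ, ∫ z, ψ ((s - T^[j] z) / a) ∂μ = a * ∫ v, ψ v * h (s - a * v) := by
    intro j
    have e1 : ∫ z, ψ ((s - T^[j] z) / a) ∂μ = ∫ u, ψ ((s - u) / a) ∂μ := by
      have := integral_map (μ := μ) (hj j).aemeasurable (f := fun u => ψ ((s - u) / a))
        (by fun_prop)
      rw [(hmp.iterate j).map_eq] at this
      exact this.symm
    rw [e1, hdens, integral_withDensity_eq_integral_toReal_smul (by fun_prop) (by simp)]
    simp only [ENNReal.toReal_ofReal (hh_nonneg _), smul_eq_mul]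
    rw [← integral_sub_left_eq_self (fun u => h u * ψ ((s - u) / a)) volume s]
    have e2 := kde_integral_comp (fun v => ψ v * h (s - a * v)) a ha 0
    rw [← e2]
    congr 1; ext w
    have : a * ((w - 0) / a) = w := by field_simp; ring
    rw [this, sub_sub_cancel, sub_zero, mul_comm]
  simp only [kdeG, traj]
  rw [integral_const_mul, integral_finsetSum]
  · simp only [key]; simp; field_simp
  · intro j _
    exact Integrable.of_bound (C := B) (by fun_prop) (ae_of_all _ fun x => hB _)

theorem bias_bound_s17
    (h : ℝ → ℝ) (hh_meas : Measurable h) (hh : Integrable h)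
    (C' β : ℝ) (hC' : 0 < C') (hβ : 0 < β)
    (hreg : ∀ σ : ℝ, (∫ s, |h s - h (s - σ)|) ≤ C' * |σ| ^ β)
    (ψ : ℝ → ℝ) (hc : Continuous ψ) (h0 : ∀ s, 0 ≤ ψ s) (hi : Integrable ψ)
    (h1 : ∫ s, ψ s = 1) (R : ℝ) (hR : 0 < R) (hRψ : ∀ v, R < |v| → ψ v = 0)
    (a : ℝ) (ha : 0 < a) :
    ∫ s, |(∫ v, ψ v * h (s - a * v)) - h s| ≤ C' * R ^ β * a ^ β := by
  have hψm := hc.measurable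
  have i1 : Integrable (fun p : ℝ × ℝ => ψ p.1 * h p.2) (volume.prod volume) := hi.mul_prod hh
  have i2 : Integrable (fun p : ℝ × ℝ => ψ p.1 * h (p.2 - a * p.1)) (volume.prod volume) := by
    rw [integrable_prod_iff (by fun_prop)]
    refine ⟨ae_of_all _ fun v => (hh.comp_sub_right (a * v)).const_mul (ψ v), ?_⟩
    simp only [norm_mul, integral_const_mul]
    have : ∀ x, ∫ y, ‖h (y - a * x)‖ = ∫ y, ‖h y‖ := fun x =>
      integral_sub_right_eq_self (fun y => ‖h y‖) (a * x)
    simp only [this]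
    exact hi.norm.mul_const _
  have i3 : Integrable (fun p : ℝ × ℝ => ψ p.1 * |h p.2 - h (p.2 - a * p.1)|)
      (volume.prod volume) := by
    refine (i1.sub i2).abs.congr (ae_of_all _ fun p => ?_)
    simp only [Pi.sub_apply]
    rw [← mul_sub, abs_mul, abs_of_nonneg (h0 _)]
  have i1s := i1.swap.prod_right_ae
  have i2s := i2.swap.prod_right_ae
  have i3s := i3.swap.prod_right_ae
  simp only [Function.comp_def, Prod.swap] at i1s i2s i3s
  have m2 : Integrable (fun s => ∫ v, ψ v * h (s - a * v)) := i2.integral_prod_right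
  have m3 : Integrable (fun s => ∫ v, ψ v * |h s - h (s - a * v)|) := i3.integral_prod_right
  calc _ ≤ ∫ s, ∫ v, ψ v * |h s - h (s - a * v)| := by
        apply integral_mono_ae (m2.sub hh).abs m3
        filter_upwards [i1s, i2s, i3s] with s a1 a2 a3
        have : h s = ∫ v, ψ v * h s := by rw [integral_mul_const, h1, one_mul]
        simp only [Pi.sub_apply]
        nth_rewrite 1 [this]
        rw [← integral_sub a2 a1]
        refine abs_integral_le_integral_abs.trans (le_of_eq ?_)
        congr 1; ext v
        rw [← mul_sub, abs_mul, abs_of_nonneg (h0 _), abs_sub_comm]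
    _ = ∫ v, ∫ s, ψ v * |h s - h (s - a * v)| :=
        (integral_integral_swap (f := fun v s => ψ v * |h s - h (s - a * v)|) i3).symm
    _ ≤ ∫ v, ψ v * (C' * R ^ β * a ^ β) := by
        apply integral_mono i3.integral_prod_left (hi.mul_const _)
        intro v
        simp only [integral_const_mul]
        by_cases hv : R < |v|
        · simp [hRψ v hv]
        · have hv := not_lt.mp hv
          apply mul_le_mul_of_nonneg_left _ (h0 v)
          refine (hreg _).trans ?_
          rw [abs_mul, abs_of_pos ha, Real.mul_rpow ha.le (abs_nonneg _)]
          have : |v| ^ β ≤ R ^ β := Real.rpow_le_rpow (abs_nonneg _) hv hβ.le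
          have h5 : 0 < a ^ β := by positivity
          calc _ ≤ C' * (a ^ β * R ^ β) := by gcongr
            _ = _ := by ring
    _ = _ := by rw [integral_mul_const, h1, one_mul]

theorem var_bound (X : Set ℝ) (M : ℝ) (hM0 : 0 ≤ M) (hM : ∀ x ∈ X, |x| ≤ M)
    (T : ℝ → ℝ) (hT : Measurable T) (hTX : Set.MapsTo T X X)
    (μ : Measure ℝ) [IsProbabilityMeasure μ] (hμX : ∀ᵐ x ∂μ, x ∈ X)
    (C : ℝ)
    (hconc : ∀ (n : ℕ), 1 ≤ n → ∀ (K : (Fin n → ℝ) → ℝ) (L : Fin n → ℝ), SepLip K L →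
      ∫ x, Real.exp (K (fun i => T^[(i : ℕ)] x)
          - ∫ z, K (fun i => T^[(i : ℕ)] z) ∂μ) ∂μ
        ≤ Real.exp (C * ∑ j, L j ^ 2))
    (ψ : ℝ → ℝ) (hc : Continuous ψ) (B : ℝ) (hB : ∀ s, |ψ s| ≤ B) (h0 : ∀ s, 0 ≤ ψ s)
    (hi : Integrable ψ) (h1 : ∫ s, ψ s = 1)
    (R : ℝ) (hR : 0 < R) (hRψ : ∀ v, R < |v| → ψ v = 0)
    (Lψ : ℝ) (hLψ : 0 < Lψ) (hψ_lip : ∀ a b : ℝ, |ψ a - ψ b| ≤ Lψ * |a - b|)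
    (a : ℝ) (ha : 0 < a) (ha1 : a ≤ 1) {n : ℕ} (hn : 1 ≤ n) :
    ∫ x, (∫ s, |kdeG ψ a (traj T n x) s - ∫ z, kdeG ψ a (traj T n z) s ∂μ|) ∂μ
      ≤ 2 * (M + R) * (2 * Real.exp C * Lψ) * (1 / (√n * a ^ 2)) := by
  have hn' : (0 : ℝ) < n := by positivity
  have hG := kdeG_prod_integrable T hT hn μ ψ hc h0 hi h1 a ha
  have hm : Integrable (fun s => ∫ z, kdeG ψ a (traj T n z) s ∂μ) := hG.integral_prod_right
  have hd : Integrable (fun p : ℝ × ℝ => |kdeG ψ a (traj T n p.1) p.2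
      - ∫ z, kdeG ψ a (traj T n z) p.2 ∂μ|) (μ.prod volume) := (hG.sub (hm.comp_snd μ)).abs
  rw [integral_integral_swap (f := fun x s => |kdeG ψ a (traj T n x) s
      - ∫ z, kdeG ψ a (traj T n z) s ∂μ|) hd]
  set A := 2 * Real.exp C * (Lψ / (√n * a ^ 2)) with hA
  have hA0 : 0 ≤ A := by positivity
  have hXT : ∀ x ∈ X, ∀ j : ℕ, T^[j] x ∈ X := fun x hx j => hTX.iterate j hx
  have hzero : ∀ s, M + R < |s| → ∀ᵐ x ∂μ, kdeG ψ a (traj T n x) s = 0 := by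
    intro s hs
    filter_upwards [hμX] with x hx
    unfold kdeG traj
    rw [Finset.sum_eq_zero, mul_zero]
    intro j _
    apply hRψ
    rw [abs_div, abs_of_pos ha, lt_div_iff₀ ha]
    have b1 := hM _ (hXT x hx j)
    have b2 := abs_sub_abs_le_abs_sub s (T^[(j : ℕ)] x)
    nlinarith
  have hind : Integrable ((Set.Icc (-(M + R)) (M + R)).indicator (fun _ : ℝ => A)) := by
    rw [integrable_indicator_iff measurableSet_Icc]
    exact integrableOn_const (by simp)
  have hval : ∫ s, (Set.Icc (-(M + R)) (M + R)).indicator (fun _ : ℝ => A) s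
      = 2 * (M + R) * A := by
    rw [integral_indicator measurableSet_Icc]
    simp only [integral_const, smul_eq_mul, measureReal_restrict_apply_univ]
    rw [Real.volume_real_Icc_of_le (by linarith)]
    ring
  calc _ ≤ ∫ s, (Set.Icc (-(M + R)) (M + R)).indicator (fun _ : ℝ => A) s := by
        apply integral_mono hd.integral_prod_right hind
        intro s
        by_cases hs : M + R < |s|
        · have z := hzero s hs
          have z2 : ∫ z, kdeG ψ a (traj T n z) s ∂μ = 0 := integral_eq_zero_of_ae z
          have z3 : ∫ x, |kdeG ψ a (traj T n x) s - ∫ z, kdeG ψ a (traj T n z) s ∂μ| ∂μ = 0 := by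
            apply integral_eq_zero_of_ae
            filter_upwards [z] with x hx
            simp [hx, z2]
          simp only [z3]
          exact Set.indicator_nonneg (fun _ _ => hA0) _
        · have hs' : s ∈ Set.Icc (-(M + R)) (M + R) := abs_le.mp (not_lt.mp hs)
          rw [Set.indicator_of_mem hs']
          have hmeas : Measurable (fun x => kdeG ψ a (traj T n x) s) :=
            (kdeG_meas T hT n ψ hc a).comp (measurable_id.prodMk measurable_const)
          set V : ℝ := ∑ j : Fin n, (Lψ / (n * a ^ 2)) ^ 2 with hV
          have hV' : V = (Lψ / (√n * a ^ 2)) ^ 2 := by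
            rw [hV]
            simp only [Finset.sum_const, Finset.card_univ, Fintype.card_fin, nsmul_eq_mul]
            rw [div_pow, div_pow, mul_pow, mul_pow, Real.sq_sqrt hn'.le]
            field_simp
          have hV0 : 0 < V := by rw [hV']; positivity
          have hVs : √V = Lψ / (√n * a ^ 2) := by rw [hV', Real.sqrt_sq (by positivity)]
          have hbd : ∀ x, |kdeG ψ a (traj T n x) s| ≤ 1 / (n * a) * ∑ j : Fin n, B := by
            intro x
            unfold kdeG
            rw [abs_mul, abs_of_nonneg (by positivity : 0 ≤ 1 / ((n : ℝ) * a))]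
            gcongr
            refine (Finset.abs_sum_le_sum_abs _ _).trans ?_
            gcongr
            exact hB _
          have := abs_mean_bound μ (fun x => kdeG ψ a (traj T n x) s
              - ∫ z, kdeG ψ a (traj T n z) s ∂μ) (hmeas.sub_const _)
            (1 / (n * a) * ∑ j : Fin n, B + |∫ z, kdeG ψ a (traj T n z) s ∂μ|)
            (fun x => (abs_sub _ _).trans (by gcongr; exact hbd x)) V C hV0
            (fun l => mgf_bound T μ C hconc hn (fun y => kdeG ψ a y s) _
              (kdeG_sepLip ψ Lψ hψ_lip a ha s) l)
          rw [hVs] at this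
          exact this
    _ = _ := by rw [hval, hA]; ring

theorem mean_bound_s17 (X : Set ℝ) (M : ℝ) (hM0 : 0 ≤ M) (hM : ∀ x ∈ X, |x| ≤ M)
    (T : ℝ → ℝ) (hT : Measurable T) (hTX : Set.MapsTo T X X)
    (μ : Measure ℝ) [IsProbabilityMeasure μ] (hμX : ∀ᵐ x ∂μ, x ∈ X) (hinv : μ.map T = μ)
    (h : ℝ → ℝ) (hh_meas : Measurable h) (hh_nonneg : ∀ s, 0 ≤ h s) (hh : Integrable h)
    (hdens : μ = MeasureTheory.volume.withDensity fun s => ENNReal.ofReal (h s))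
    (C' β : ℝ) (hC' : 0 < C') (hβ : 0 < β)
    (hreg : ∀ σ : ℝ, (∫ s, |h s - h (s - σ)|) ≤ C' * |σ| ^ β)
    (C : ℝ)
    (hconc : ∀ (n : ℕ), 1 ≤ n → ∀ (K : (Fin n → ℝ) → ℝ) (L : Fin n → ℝ), SepLip K L →
      ∫ x, Real.exp (K (fun i => T^[(i : ℕ)] x)
          - ∫ z, K (fun i => T^[(i : ℕ)] z) ∂μ) ∂μ
        ≤ Real.exp (C * ∑ j, L j ^ 2))
    (ψ : ℝ → ℝ) (hc : Continuous ψ) (B : ℝ) (hB : ∀ s, |ψ s| ≤ B) (h0 : ∀ s, 0 ≤ ψ s)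
    (hi : Integrable ψ) (h1 : ∫ s, ψ s = 1)
    (R : ℝ) (hR : 0 < R) (hRψ : ∀ v, R < |v| → ψ v = 0)
    (Lψ : ℝ) (hLψ : 0 < Lψ) (hψ_lip : ∀ a b : ℝ, |ψ a - ψ b| ≤ Lψ * |a - b|)
    (a : ℝ) (ha : 0 < a) (ha1 : a ≤ 1) {n : ℕ} (hn : 1 ≤ n) :
    ∫ x, kdeK ψ h a (traj T n x) ∂μ
      ≤ C' * R ^ β * a ^ β + 2 * (M + R) * (2 * Real.exp C * Lψ) * (1 / (√n * a ^ 2)) := by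
  have hG := kdeG_prod_integrable T hT hn μ ψ hc h0 hi h1 a ha
  have hm : Integrable (fun s => ∫ z, kdeG ψ a (traj T n z) s ∂μ) := hG.integral_prod_right
  have hd : Integrable (fun p : ℝ × ℝ => |kdeG ψ a (traj T n p.1) p.2
      - ∫ z, kdeG ψ a (traj T n z) p.2 ∂μ|) (μ.prod volume) := (hG.sub (hm.comp_snd μ)).abs
  have hd2 : Integrable (fun p : ℝ × ℝ => |kdeG ψ a (traj T n p.1) p.2
      - h p.2|) (μ.prod volume) := (hG.sub (hh.comp_snd μ)).abs
  have hv := var_bound X M hM0 hM T hT hTX μ hμX C hconc ψ hc B hB h0 hi h1 R hR hRψ Lψ hLψ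
    hψ_lip a ha ha1 hn
  have hb := bias_bound_s17 h hh_meas hh C' β hC' hβ hreg ψ hc h0 hi h1 R hR hRψ a ha
  simp only [← mean_formula T hT hn μ hinv h hh_meas hh_nonneg hdens ψ hc B hB a ha] at hb
  set m := fun s => ∫ z, kdeG ψ a (traj T n z) s ∂μ with hmdef
  have q2 : Integrable (fun s => |m s - h s|) := (hm.sub hh).abs
  have q1 : ∀ x, Integrable (fun s => |kdeG ψ a (traj T n x) s - m s|) := fun x =>
    ((kdeG_integrable ψ hi a ha _).sub hm).abs
  have q3 : ∀ x, Integrable (fun s => |kdeG ψ a (traj T n x) s - h s|) := fun x =>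
    ((kdeG_integrable ψ hi a ha _).sub hh).abs
  have hd' : Integrable (fun x => ∫ s, |kdeG ψ a (traj T n x) s - m s|) μ := hd.integral_prod_left
  calc _ ≤ ∫ x, ((∫ s, |kdeG ψ a (traj T n x) s - m s|) + ∫ s, |m s - h s|) ∂μ := by
        apply integral_mono hd2.integral_prod_left (hd'.add (integrable_const _))
        intro x
        simp only [Pi.add_apply]
        rw [← integral_add (q1 x) q2]
        apply integral_mono (q3 x) ((q1 x).add q2)
        intro s
        exact abs_sub_le _ _ _
    _ ≤ _ := by
        rw [integral_add hd' (integrable_const _)]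
        simp only [integral_const, probReal_univ, one_smul]
        linarith

set_option maxHeartbeats 2000000 in
theorem observed_kernel_density_estimator_exponential
    (X : Set ℝ) (hXb : Bornology.IsBounded X) (hXm : MeasurableSet X)
    (T : ℝ → ℝ) (hT : Measurable T) (hTX : Set.MapsTo T X X)
    (μ : Measure ℝ) [IsProbabilityMeasure μ] (hμX : μ X = 1) (hinv : μ.map T = μ)
    (h : ℝ → ℝ) (hh_meas : Measurable h) (hh_nonneg : ∀ s, 0 ≤ h s)
    (hdens : μ = MeasureTheory.volume.withDensity fun s => ENNReal.ofReal (h s))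
    (C' β : ℝ) (hC' : 0 < C') (hβ : 0 < β)
    (hreg : ∀ σ : ℝ, (∫ s, |h s - h (s - σ)|) ≤ C' * |σ| ^ β)
    (C : ℝ) (hC : 0 < C)
    (hconc : ∀ (n : ℕ), 1 ≤ n → ∀ (K : (Fin n → ℝ) → ℝ) (L : Fin n → ℝ), SepLip K L →
      ∫ x, Real.exp (K (fun i => T^[(i : ℕ)] x)
          - ∫ z, K (fun i => T^[(i : ℕ)] z) ∂μ) ∂μ
        ≤ Real.exp (C * ∑ j, L j ^ 2))
    (ψ : ℝ → ℝ) (hψ_nonneg : ∀ s, 0 ≤ ψ s) (hψ_supp : HasCompactSupport ψ)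
    (Lψ : ℝ) (hLψ : 0 ≤ Lψ) (hψ_lip : ∀ a b : ℝ, |ψ a - ψ b| ≤ Lψ * |a - b|)
    (hψ_int : (∫ s, ψ s) = 1)
    (α : ℕ → ℝ) (hα : ∀ n, 0 < α n)
    (P : Measure ℝ) [IsProbabilityMeasure P] (hP : ∀ᵐ ξ ∂P, |ξ| ≤ 1) :
    ∃ Cψ : ℝ, 0 < Cψ ∧ ∃ D : ℝ, 0 < D ∧ ∀ ε : ℝ, 0 < ε → ∀ (n : ℕ), 1 ≤ n →
      ∀ t : ℝ, Cψ * ((α n) ^ β + 1 / (Real.sqrt n * (α n) ^ 2)) < t →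
      ((μ.prod (Measure.pi fun _ : Fin n => P))
          {p | t + Lψ * ε / (α n) ^ 2 < ∫ s, |(1 / ((n : ℝ) * α n))
            * ∑ j : Fin n, ψ ((s - (T^[(j : ℕ)] p.1 + ε * p.2 j)) / α n) - h s|}).toReal
        ≤ Real.exp (-((n : ℝ) * (α n) ^ 4 * t ^ 2)
            / (4 * D * Lψ ^ 2 * (1 + ε ^ 2))) := by
  have hc : Continuous ψ := by
    have : LipschitzWith ⟨Lψ, hLψ⟩ ψ := LipschitzWith.of_dist_le_mul fun a b => by
      rw [Real.dist_eq, Real.dist_eq]; exact hψ_lip a b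
    exact this.continuous
  have hi : Integrable ψ := hc.integrable_of_hasCompactSupport hψ_supp
  obtain ⟨B, hB⟩ := hψ_supp.exists_bound_of_continuous hc
  have hB : ∀ s, |ψ s| ≤ B := hB
  obtain ⟨R, hR1, hRψ⟩ : ∃ R : ℝ, 1 ≤ R ∧ ∀ v, R < |v| → ψ v = 0 := by
    obtain ⟨r, hr⟩ := hψ_supp.isCompact.isBounded.subset_closedBall 0
    refine ⟨max r 1, le_max_right _ _, fun v hv => ?_⟩
    by_contra hne
    have := hr (subset_tsupport ψ hne)
    simp [Real.norm_eq_abs] at this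
    have := le_max_left r 1
    linarith
  have hR : 0 < R := by linarith
  obtain ⟨M, hM0, hM⟩ : ∃ M : ℝ, 0 ≤ M ∧ ∀ x ∈ X, |x| ≤ M := by
    obtain ⟨r, hr⟩ := hXb.subset_closedBall 0
    refine ⟨max r 0, le_max_right _ _, fun v hv => ?_⟩
    have := hr hv
    simp only [Metric.mem_closedBall, dist_zero_right, Real.norm_eq_abs] at this
    exact this.trans (le_max_left _ _)
  have hLpos : 0 < Lψ := by
    rcases hLψ.lt_or_eq with h1 | h1
    · exact h1
    · exfalso
      have hz : ∀ v, ψ v = 0 := fun v => by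
        have h2 := hψ_lip v (R + 1)
        rw [← h1, zero_mul] at h2
        have h3 := abs_nonpos_iff.mp h2
        have h4 := hRψ (R + 1) (by rw [abs_of_pos (by linarith)]; linarith)
        linarith
      simp [hz] at hψ_int
  have hXae : ∀ᵐ x ∂μ, x ∈ X := (prob_compl_eq_zero_iff hXm).mpr hμX
  have hlint : ∫⁻ s, ENNReal.ofReal (h s) = 1 := by
    have := measure_univ (μ := μ)
    rw [hdens, withDensity_apply _ MeasurableSet.univ, Measure.restrict_univ] at this
    exact this
  have hh : Integrable h := by
    refine ⟨hh_meas.aestronglyMeasurable, ?_⟩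
    rw [hasFiniteIntegral_iff_ofReal (ae_of_all _ hh_nonneg), hlint]
    exact ENNReal.one_lt_top
  have hh1 : ∫ s, h s = 1 := by
    rw [integral_eq_lintegral_of_nonneg_ae (ae_of_all _ hh_nonneg) hh_meas.aestronglyMeasurable,
      hlint]; rfl
  set δ : ℝ := 1 / (4 * R) with hδ
  have hδ0 : 0 < δ := by positivity
  set c1 := C' * R ^ β with hc1
  set c2 := 2 * (M + R) * (2 * Real.exp C * Lψ) with hc2
  have hc10 : 0 < c1 := by positivity
  have hc20 : 0 < c2 := by positivity
  refine ⟨2 / δ ^ β + 2 * c1 + 2 * c2, by positivity, 64 * C * R ^ 2, by positivity, ?_⟩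
  intro ε hε n hn t ht
  have hn' : (0 : ℝ) < n := by positivity
  set a := α n with hadef
  have ha : 0 < a := hα n
  have haβ : 0 < a ^ β := by positivity
  have hw : 0 < 1 / (√n * a ^ 2) := by positivity
  have ht0 : 0 < t := lt_trans (by positivity) ht
  change ((μ.prod (Measure.pi fun _ : Fin n => P))
      {p | t + Lψ * ε / a ^ 2 < kdeK ψ h a (fun j : Fin n => T^[(j : ℕ)] p.1 + ε * p.2 j)}).toReal
      ≤ _
  by_cases ht2 : 2 ≤ t
  · have : {p : ℝ × (Fin n → ℝ) | t + Lψ * ε / a ^ 2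
        < kdeK ψ h a (fun j : Fin n => T^[(j : ℕ)] p.1 + ε * p.2 j)} = ∅ := by
      ext p
      simp only [Set.mem_ofPred_eq, Set.mem_empty_iff_false, iff_false, not_lt]
      have h1 := kdeK_le_two hn ψ h hψ_nonneg hi hψ_int hh hh_nonneg hh1 a ha
        (fun j : Fin n => T^[(j : ℕ)] p.1 + ε * p.2 j)
      have h2 : 0 < Lψ * ε / a ^ 2 := by positivity
      linarith
    rw [this]
    simp only [measure_empty, ENNReal.toReal_zero]
    positivity
  have ht2 := not_le.mp ht2
  have haδ : a ≤ δ := by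
    by_contra hcon
    have hcon := not_le.mp hcon
    have h1 : δ ^ β ≤ a ^ β := Real.rpow_le_rpow hδ0.le hcon.le hβ.le
    have h2 : 2 ≤ 2 / δ ^ β * a ^ β := by
      rw [div_mul_eq_mul_div, le_div_iff₀ (by positivity)]; linarith
    have h3 : 2 / δ ^ β * a ^ β
        ≤ (2 / δ ^ β + 2 * c1 + 2 * c2) * (a ^ β + 1 / (√n * a ^ 2)) := by
      have : 0 < 2 / δ ^ β := by positivity
      apply mul_le_mul <;> first | positivity | linarith
    linarith
  have haR : 4 * R * a ≤ 1 := by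
    rw [hδ, le_div_iff₀ (by positivity)] at haδ; linarith
  have ha1 : a ≤ 1 := by nlinarith
  have hmean := mean_bound_s17 X M hM0 hM T hT hTX μ hXae hinv h hh_meas hh_nonneg hh hdens C' β hC' hβ
    hreg C hconc ψ hc B hB hψ_nonneg hi hψ_int R hR hRψ Lψ hLpos hψ_lip a ha ha1 hn
  rw [← hc1, ← hc2] at hmean
  have hmean2 : ∫ x, kdeK ψ h a (traj T n x) ∂μ ≤ t / 2 := by
    refine hmean.trans ?_
    have : 0 < 2 / δ ^ β := by positivity
    have p1 := mul_pos hc10 hw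
    have p2 := mul_pos hc20 haβ
    have p3 := mul_pos this haβ
    have p4 := mul_pos this hw
    nlinarith
  have hKc : Measurable (fun x => kdeK ψ h a (traj T n x)) := by
    have hG := kdeG_meas T hT n ψ hc a
    have : Measurable (fun p : ℝ × ℝ => |kdeG ψ a (traj T n p.1) p.2 - h p.2|) := by fun_prop
    exact (this.stronglyMeasurable.integral_prod_right).measurable
  have hK2 : ∀ x, |kdeK ψ h a (traj T n x)| ≤ 2 := fun x => by
    have h00 : 0 ≤ kdeK ψ h a (traj T n x) := integral_nonneg fun s => abs_nonneg _
    rw [abs_of_nonneg h00]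
    exact kdeK_le_two hn ψ h hψ_nonneg hi hψ_int hh hh_nonneg hh1 a ha _
  set V : ℝ := ∑ j : Fin n, (4 * R * Lψ / (n * a)) ^ 2 with hV
  have hV' : V = 16 * R ^ 2 * Lψ ^ 2 / (n * a ^ 2) := by
    rw [hV]
    simp only [Finset.sum_const, Finset.card_univ, Fintype.card_fin, nsmul_eq_mul]
    field_simp; ring
  have hV0 : 0 < V := by rw [hV']; positivity
  set E := ∫ x, kdeK ψ h a (traj T n x) ∂μ with hE
  have htail := tail_bound μ (fun x => kdeK ψ h a (traj T n x) - E) (hKc.sub_const _)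
    (2 + |E|) (fun x => (abs_sub _ _).trans (by gcongr; exact hK2 x)) V C hV0 hC
    (fun l => mgf_bound T μ C hconc hn (kdeK ψ h a) _
      (kdeK_sepLip ψ h hi hh R Lψ hR hLψ hRψ hψ_lip a ha) l) (t / 2) (by positivity)
  set S : Set ℝ := {x | t / 2 ≤ kdeK ψ h a (traj T n x) - E} with hS
  have hnoise : ∀ᵐ p ∂(μ.prod (Measure.pi fun _ : Fin n => P)), ∀ j, |p.2 j| ≤ 1 := by
    rw [ae_all_iff]
    intro j
    have e1 : ∀ᵐ q ∂(Measure.pi fun _ : Fin n => P), |q j| ≤ 1 :=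
      (measurePreserving_eval (fun _ : Fin n => P) j).quasiMeasurePreserving.ae hP
    exact Measure.quasiMeasurePreserving_snd.ae e1
  have hincl : (μ.prod (Measure.pi fun _ : Fin n => P))
      {p | t + Lψ * ε / a ^ 2 < kdeK ψ h a (fun j : Fin n => T^[(j : ℕ)] p.1 + ε * p.2 j)}
      ≤ (μ.prod (Measure.pi fun _ : Fin n => P)) (S ×ˢ Set.univ) := by
    apply measure_mono_ae
    filter_upwards [hnoise] with p hp hlt
    change t + Lψ * ε / a ^ 2 < kdeK ψ h a (fun j : Fin n => T^[(j : ℕ)] p.1 + ε * p.2 j) at hlt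
    refine ⟨?_, trivial⟩
    change t / 2 ≤ kdeK ψ h a (traj T n p.1) - E
    have h1 := kdeK_sub ψ h hi hh R Lψ hR hLψ hRψ hψ_lip a ha
      (fun j : Fin n => T^[(j : ℕ)] p.1 + ε * p.2 j) (traj T n p.1)
    have h2 : ∑ j : Fin n, |(T^[(j : ℕ)] p.1 + ε * p.2 j) - traj T n p.1 j| ≤ n * ε := by
      calc _ ≤ ∑ j : Fin n, ε := by
            gcongr with j
            simp only [traj, add_sub_cancel_left, abs_mul, abs_of_pos hε]
            have := hp j
            nlinarith
        _ = _ := by simp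
    have h3 : 4 * R * Lψ / (n * a) * ∑ j : Fin n, |(T^[(j : ℕ)] p.1 + ε * p.2 j)
        - traj T n p.1 j| ≤ Lψ * ε / a ^ 2 := by
      calc _ ≤ 4 * R * Lψ / (n * a) * (n * ε) := by gcongr
        _ = (4 * R * a) * (Lψ * ε / a ^ 2) := by field_simp
        _ ≤ 1 * (Lψ * ε / a ^ 2) := by gcongr
        _ = _ := one_mul _
    have h4 := (le_abs_self _).trans (h1.trans h3)
    linarith
  rw [Measure.prod_prod, measure_univ, mul_one] at hincl
  refine (ENNReal.toReal_mono (measure_ne_top _ _) hincl).trans (htail.trans ?_)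
  apply Real.exp_le_exp.mpr
  rw [neg_div, neg_le_neg_iff, hV']
  have e1 : (t / 2) ^ 2 / (4 * C * (16 * R ^ 2 * Lψ ^ 2 / (n * a ^ 2)))
      = (n * a ^ 2 * t ^ 2) / (4 * (64 * C * R ^ 2) * Lψ ^ 2 * 1) := by
    field_simp; norm_num
  rw [e1]
  have ha2 : a ^ 4 ≤ a ^ 2 := pow_le_pow_of_le_one ha.le ha1 (by norm_num)
  gcongr
  nlinarith [sq_nonneg ε]
end
end
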